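/- arXiv:2502.13528 — 6 statements merged into one kernel-verified Lean document; each statement's English description precedes it below -/
import Mathlib

section
/- Affine Cartier–Frobenius descent (descent direction of Theorem B.1): let M be an A-module equipped with a flat connection ∇ of vanishing p-curvature, and let M^∇ = {m ∈ M : ∇_D(m) = 0 for every k-derivation D of A}, regarded as a module over the subring A^p. Then the natural map A ⊗_{A^p} M^∇ → M sending a ⊗ m to a·m is bijective. -/
/-!
Affine Cartier–Frobenius descent (descent direction): if `M` is an `A`-module with a flat
connection `∇` of vanishing `p`-curvature, then the natural map
`A ⊗_{A^p} M^∇ → M`, `a ⊗ m ↦ a • m`, is bijective.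
Here `A^p = (frobenius A p).range` is the subring of `p`-th powers.
-/

universe u v

open scoped TensorProduct

/-- The `A^p`-submodule `M^∇` of horizontal elements of `M`. -/
noncomputable def horizontalSubmodule {k A : Type u} [Field k] [CommRing A] [Algebra k A]
    (p : ℕ) [Fact p.Prime] [CharP A p]
    (M : Type v) [AddCommGroup M] [Module k M] [Module A M] [IsScalarTower k A M]
    (nabla : Derivation k A A → Module.End k M)
    (leibniz : ∀ (D : Derivation k A A) (a : A) (m : M),
      nabla D (a • m) = D a • m + a • nabla D m) :
    Submodule (frobenius A p).range M where
  carrier := {m : M | ∀ D : Derivation k A A, nabla D m = 0}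
  add_mem' := by intro a b ha hb D; rw [map_add, ha D, hb D, add_zero]
  zero_mem' := fun D => map_zero _
  smul_mem' := by
    rintro ⟨c, b, rfl⟩ m hm D
    have hD : D (frobenius A p b) = 0 := by
      rw [frobenius_def, Derivation.leibniz_pow]
      simp [nsmul_eq_mul, CharP.cast_eq_zero A p]
    show nabla D ((⟨frobenius A p b, _⟩ : (frobenius A p).range) • m) = 0
    rw [Subring.smul_def, leibniz, hm D, smul_zero, add_zero, hD, zero_smul]

theorem pow_mul_eq_mul_pow_add {R : Type*} [Ring R] {T x g : R} (h : T * x = x * T + g)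
    (hg : Commute T g) (n : ℕ) : T ^ n * x = x * T ^ n + n • (g * T ^ (n - 1)) := by
  induction n with
  | zero => simp
  | succ n ih =>
    have h1 : n • (T * (g * T ^ (n - 1))) = n • (g * T ^ n) := by
      rcases n with _ | n
      · simp
      · rw [← mul_assoc, hg.eq, mul_assoc, ← pow_succ', Nat.add_sub_cancel]
    rw [pow_succ', mul_assoc, ih, mul_add, ← mul_assoc, h, mul_smul_comm, h1, add_mul, mul_assoc,
      Nat.add_sub_cancel, succ_nsmul]
    abel

theorem AddSubgroup.mem_of_nsmul_mem_of_char {R : Type*} [Ring R] {p : ℕ} [Fact p.Prime]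
    (hp : (p : R) = 0) (L : AddSubgroup R) {n : ℕ} (hn : 0 < n) (hnp : n < p) {y : R}
    (hy : n • y ∈ L) : y ∈ L := by
  have hc : Nat.Coprime n p := ((Fact.out : p.Prime).coprime_iff_not_dvd.mpr
    (Nat.not_dvd_of_pos_of_lt hn hnp)).symm
  have h := Nat.gcd_eq_gcd_ab n p
  rw [hc.gcd_eq_one] at h
  have h2 : y = n.gcdA p • (n • y) := by
    have := congrArg (fun z : ℤ => (z : R) * y) h
    simp only [Nat.cast_one, Int.cast_one, one_mul, Int.cast_add, Int.cast_mul, Int.cast_natCast,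
      hp, zero_mul, add_zero] at this
    rw [zsmul_eq_mul, nsmul_eq_mul, ← mul_assoc, ← (Nat.cast_commute n _).eq]
    exact this
  rw [h2]
  exact L.zsmul_mem hy _

/-- The additive span of the products `μ c * Q`, with `Q ∈ S` annihilated on the left by all
`T i`, `i ∈ s`. -/
def annihilatedSpan {A R ι : Type*} [CommRing A] [Ring R] (S : Subring R) (μ : A →+* R)
    (T : ι → R) (s : Finset ι) : AddSubgroup R :=
  AddSubgroup.closure {r | ∃ c : A, ∃ Q ∈ S, (∀ i ∈ s, T i * Q = 0) ∧ r = μ c * Q}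

theorem mul_mem_annihilatedSpan {A R ι : Type*} [CommRing A] [Ring R] {S : Subring R}
    {μ : A →+* R} {T : ι → R} {s : Finset ι} (c : A) {r : R} (hr : r ∈ annihilatedSpan S μ T s) :
    μ c * r ∈ annihilatedSpan S μ T s := by
  induction hr using AddSubgroup.closure_induction with
  | mem r hr =>
    obtain ⟨b, Q, hQ, hT, rfl⟩ := hr
    exact AddSubgroup.subset_closure ⟨c * b, Q, hQ, hT, by rw [map_mul, mul_assoc]⟩
  | zero => rw [mul_zero]; exact zero_mem _
  | add a b _ _ ha hb => rw [mul_add]; exact add_mem ha hb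
  | neg a _ ha => rw [mul_neg]; exact neg_mem ha

section Weyl

variable {A R ι : Type*} [CommRing A] [Ring R] [DecidableEq ι] {p : ℕ} [Fact p.Prime]
  {S : Subring R} {μ : A →+* R} {T : ι → R} {x : ι → A} {g : A}

theorem pow_mul_mem_annihilatedSpan (hp : (p : R) = 0)
    (hSμ : ∀ a, μ a ∈ S) (hST : ∀ i, T i ∈ S)
    (hTx : ∀ i j, T i * μ (x j) = μ (x j) * T i + if i = j then μ g else 0)
    (hTg : ∀ i, Commute (T i) (μ g)) (hTT : ∀ i j, Commute (T i) (T j))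
    (hTp : ∀ i, T i ^ p = 0) {s : Finset ι} {j : ι} (hj : j ∉ s) (k : ℕ) (hk : k ≤ p - 1) :
    ∀ Q ∈ S, (∀ i ∈ s, T i * Q = 0) →
      μ (g ^ k) * (T j ^ (p - 1 - k) * Q) ∈ annihilatedSpan S μ T (insert j s) := by
  have hp1 : 1 < p := (Fact.out : p.Prime).one_lt
  induction k with
  | zero =>
    intro Q hQ hT
    refine AddSubgroup.subset_closure ⟨g ^ 0, _, S.mul_mem (S.pow_mem (hST j) _) hQ, ?_, rfl⟩
    intro i hi
    rcases Finset.mem_insert.mp hi with rfl | hi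
    · rw [← mul_assoc, ← pow_succ', Nat.sub_zero, Nat.sub_add_cancel hp1.le, hTp, zero_mul]
    · rw [← mul_assoc, ((hTT i j).pow_right _).eq, mul_assoc, hT i hi, mul_zero]
  | succ k ih =>
    intro Q hQ hT
    have ih := ih (by omega)
    have h1 := ih (μ (x j) * Q) (S.mul_mem (hSμ _) hQ) (fun i hi => by
      have hij : i ≠ j := fun h => hj (h ▸ hi)
      rw [← mul_assoc, hTx, if_neg hij, add_zero, mul_assoc, hT i hi, mul_zero])
    have h2 := mul_mem_annihilatedSpan (x j) (ih Q hQ hT)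
    have h3 := sub_mem h1 h2
    have hx : T j * μ (x j) = μ (x j) * T j + μ g := by rw [hTx, if_pos rfl]
    refine AddSubgroup.mem_of_nsmul_mem_of_char hp _ (n := p - 1 - k) (by omega) (by omega) ?_
    convert h3 using 1
    rw [← mul_assoc (T j ^ _), pow_mul_eq_mul_pow_add hx (hTg j), ← mul_assoc (μ (x j)),
      ← map_mul, mul_comm (x j), map_mul, add_mul, mul_add, mul_assoc (μ (x j)),
      mul_assoc (μ (g ^ k)), add_sub_cancel_left, smul_mul_assoc, mul_smul_comm, pow_succ, map_mul,
      mul_assoc, mul_assoc, Nat.sub_sub (p - 1) k 1]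

/-- In an algebra with Weyl-type relations `[T i, x j] = δ i j * g` and `T i ^ p = 0`,
a power of `g` is a combination of operators annihilated by every `T i`. -/
theorem exists_pow_mem_annihilatedSpan (hp : (p : R) = 0)
    (hSμ : ∀ a, μ a ∈ S) (hST : ∀ i, T i ∈ S)
    (hTx : ∀ i j, T i * μ (x j) = μ (x j) * T i + if i = j then μ g else 0)
    (hTg : ∀ i, Commute (T i) (μ g)) (hTT : ∀ i j, Commute (T i) (T j))
    (hTp : ∀ i, T i ^ p = 0) (s : Finset ι) :
    ∃ N : ℕ, μ (g ^ N) ∈ annihilatedSpan S μ T s := by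
  induction s using Finset.induction_on with
  | empty =>
    exact ⟨0, AddSubgroup.subset_closure ⟨1, 1, S.one_mem, by simp, by simp⟩⟩
  | insert j s hj ih =>
    obtain ⟨N, hN⟩ := ih
    refine ⟨p - 1 + N, ?_⟩
    rw [pow_add, map_mul]
    generalize μ (g ^ N) = r at hN
    induction hN using AddSubgroup.closure_induction with
    | mem r hr =>
      obtain ⟨b, Q, hQ, hT, rfl⟩ := hr
      rw [← mul_assoc, ← map_mul, mul_comm, map_mul, mul_assoc]
      refine mul_mem_annihilatedSpan b ?_
      simpa using pow_mul_mem_annihilatedSpan hp hSμ hST hTx hTg hTT hTp hj (p - 1) le_rfl Q hQ hT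
    | zero => rw [mul_zero]; exact zero_mem _
    | add a b _ _ ha hb => rw [mul_add]; exact add_mem ha hb
    | neg a _ ha => rw [mul_neg]; exact neg_mem ha

end Weyl

/-- The `p`-th iterate of a derivation in characteristic `p` is a derivation. -/
theorem Derivation.exists_eq_pow_char {k A : Type*} [Field k] [CommRing A] [Algebra k A]
    (p : ℕ) [Fact p.Prime] [CharP k p] [Nontrivial A] (D : Derivation k A A) :
    ∃ D' : Derivation k A A, (D' : A →ₗ[k] A) = (D : A →ₗ[k] A) ^ p := by
  set T : Module.End k A := (D : A →ₗ[k] A) with hT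
  let μ := Algebra.lmul k A
  let L : Module.End k (Module.End k A) := LinearMap.mulLeft k T
  let R : Module.End k (Module.End k A) := LinearMap.mulRight k T
  let E := L - R
  have : CharP (Module.End k (Module.End k A)) p :=
    charP_of_injective_algebraMap (algebraMap k _).injective p
  have hE : ∀ a, E (μ a) = μ (T a) := by
    intro a
    ext b
    simp [E, L, R, μ, hT, mul_comm]
  have hEn : ∀ n a, (E ^ n) (μ a) = μ ((T ^ n) a) := by
    intro n
    induction n with
    | zero => intro a; simp
    | succ n ih => intro a; rw [pow_succ, Module.End.mul_apply, hE, ih, pow_succ]; rfl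
  have hEp : E ^ p = LinearMap.mulLeft k (T ^ p) - LinearMap.mulRight k (T ^ p) := by
    have hLR : Commute L R := LinearMap.commute_mulLeft_right T T
    rw [← LinearMap.pow_mulLeft, ← LinearMap.pow_mulRight]
    exact sub_pow_char_of_commute (R := Module.End k (Module.End k A)) p hLR
  refine ⟨Derivation.mk' (T ^ p) fun a b => ?_, rfl⟩
  have h := LinearMap.congr_fun (hEn p a) b
  rw [hEp] at h
  simp only [LinearMap.sub_apply, LinearMap.mulLeft_apply, LinearMap.mulRight_apply, μ,
    Module.End.mul_apply] at h
  rw [sub_eq_iff_eq_add] at h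
  simp only [Algebra.coe_lmul_eq_mul, LinearMap.mul_apply'] at h
  rw [h, smul_eq_mul, smul_eq_mul]
  ring

theorem Derivation.pow_apply_mul_pow {k A : Type*} [CommRing k] [CommRing A] [Algebra k A]
    (D : Derivation k A A) {b x g : A} (hb : D b = 0) (hg : D g = 0) (hx : D x = g) (n j : ℕ) :
    ((D : A →ₗ[k] A) ^ n) (b * x ^ j) = j.descFactorial n • (b * g ^ n * x ^ (j - n)) := by
  induction n with
  | zero => simp
  | succ n ih =>
    have hbg : D (b * g ^ n) = 0 := by simp [D.leibniz, D.leibniz_pow, hb, hg]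
    rw [pow_succ', Module.End.mul_apply, ih, map_nsmul, Derivation.coeFn_coe, D.leibniz,
      D.leibniz_pow, hbg, hx, Nat.descFactorial_succ, mul_comm, mul_smul, Nat.sub_sub]
    simp only [smul_eq_mul, nsmul_eq_mul, mul_zero, add_zero, Nat.cast_mul]
    ring

theorem Nat.Prime.dvd_succ_or_dvd_descFactorial {p : ℕ} (hp : p.Prime) (j : ℕ) :
    p ∣ j + 1 ∨ p ∣ j.descFactorial (p - 1) := by
  rw [← hp.dvd_mul]
  obtain ⟨q, rfl⟩ := Nat.exists_eq_succ_of_ne_zero hp.ne_zero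
  rw [Nat.succ_sub_one, ← Nat.succ_descFactorial_succ]
  exact (Nat.dvd_factorial hp.pos le_rfl).trans (Nat.factorial_dvd_descFactorial _ _)

section Coefficients

variable {k A : Type*} [Field k] [CommRing A] [Algebra k A] {p : ℕ} [Fact p.Prime] [CharP k p]

theorem Derivation.pow_pred_apply_mem (D : Derivation k A A) (S : Subalgebra k A) {x g : A}
    (hS : ∀ b ∈ S, D b = 0) (hpow : ∀ a : A, a ^ p ∈ S) (hg : g ∈ S) (hx : D x = g) {a : A}
    (ha : a ∈ S ⊔ Algebra.adjoin k {x}) : ((D : A →ₗ[k] A) ^ (p - 1)) a ∈ S := by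
  have hp : p.Prime := Fact.out
  have hA : (p : A) = 0 := by
    rw [← _root_.map_natCast (algebraMap k A), CharP.cast_eq_zero, map_zero]
  rw [← Subalgebra.mem_toSubmodule, Algebra.sup_def, Algebra.adjoin_union_coe_submodule,
    Algebra.adjoin_eq, Algebra.adjoin_eq] at ha
  induction ha using Submodule.mul_induction_on' with
  | mem_mul_mem b hb c hc =>
    rw [Subalgebra.mem_toSubmodule, Algebra.adjoin_singleton_eq_range_aeval] at hc
    rw [Subalgebra.mem_toSubmodule] at hb
    obtain ⟨f, rfl⟩ := hc
    induction f using Polynomial.induction_on' with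
    | add f f' hf hf' => rw [map_add, mul_add, map_add]; exact S.add_mem hf hf'
    | monomial j c =>
      change ((D : A →ₗ[k] A) ^ (p - 1)) (b * Polynomial.aeval x (Polynomial.monomial j c)) ∈ S
      rw [Polynomial.aeval_monomial, ← mul_assoc,
        D.pow_apply_mul_pow (hS _ (S.mul_mem hb (S.algebraMap_mem c))) (hS g hg) hx]
      rcases hp.dvd_succ_or_dvd_descFactorial j with ⟨q, hq⟩ | ⟨q, hq⟩
      · refine S.nsmul_mem (S.mul_mem (S.mul_mem (S.mul_mem hb (S.algebraMap_mem c))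
          (S.pow_mem hg _)) ?_) _
        obtain ⟨q, rfl⟩ : ∃ r, q = r + 1 :=
          Nat.exists_eq_succ_of_ne_zero (by rintro rfl; simp at hq)
        have : j - (p - 1) = q * p := by
          have := hp.pos
          rw [mul_add, mul_one, mul_comm] at hq
          omega
        rw [this, pow_mul]
        exact hpow _
      · rw [hq, nsmul_eq_mul, Nat.cast_mul, hA, zero_mul, zero_mul]
        exact S.zero_mem
  | add a _ b _ ha hb => rw [map_add]; exact S.add_mem ha hb

theorem Derivation.pow_mul_mem_of_apply_eq_zero (D : Derivation k A A) (S : Subalgebra k A)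
    {x g : A} (hS : ∀ b ∈ S, D b = 0) (hpow : ∀ a : A, a ^ p ∈ S) (hg : g ∈ S) (hx : D x = g)
    {a : A} (ha : a ∈ S ⊔ Algebra.adjoin k {x}) (hDa : D a = 0) : g ^ (p - 1) * a ∈ S := by
  have h := D.pow_pred_apply_mem (p := p) S hS hpow hg hx (a := a * x ^ (p - 1))
    (mul_mem ha (pow_mem ((le_sup_right : _ ≤ S ⊔ Algebra.adjoin k {x})
      (Algebra.self_mem_adjoin_singleton k x)) _))
  rw [D.pow_apply_mul_pow hDa (hS g hg) hx, Nat.sub_self, pow_zero, mul_one,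
    Nat.descFactorial_self] at h
  have hf : ((p - 1).factorial : k) ≠ 0 := by
    rw [Ne, CharP.cast_eq_zero_iff k p, (Fact.out : p.Prime).dvd_factorial]
    have := (Fact.out : p.Prime).pos
    omega
  have h2 := S.smul_mem h ((p - 1).factorial : k)⁻¹
  rwa [← Nat.cast_smul_eq_nsmul k, smul_smul, inv_mul_cancel₀ hf, one_smul, mul_comm] at h2

variable {ι : Type*} [DecidableEq ι] {x : ι → A} {g : A} {D : ι → Derivation k A A}

/-- An element of `k[P, x i (i ∈ s)]`, where `P` is the ring of `p`-th powers, which is annihilated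
by derivations `D i` with `D i (x j) = δ i j * g` lies in `k[P]` up to a power of `g`. -/
theorem exists_pow_mul_mem_adjoin_of_apply_eq_zero {P : Set A} (hP : ∀ a : A, a ^ p ∈ P)
    (hDP : ∀ i, ∀ a ∈ P, D i a = 0) (hg : g ∈ P)
    (hx : ∀ i j, D i (x j) = if i = j then g else 0) (s : Finset ι) :
    ∃ N : ℕ, ∀ a ∈ Algebra.adjoin k (P ∪ x '' s), (∀ i ∈ s, D i a = 0) →
      g ^ N * a ∈ Algebra.adjoin k P := by
  induction s using Finset.induction_on with
  | empty => exact ⟨0, fun a ha _ => by simpa using ha⟩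
  | insert j s hj ih =>
    obtain ⟨N, hN⟩ := ih
    refine ⟨N + (p - 1), fun a ha hDa => ?_⟩
    set S := Algebra.adjoin k (P ∪ x '' s) with hSdef
    have hPS : P ⊆ S := Set.subset_union_left.trans Algebra.subset_adjoin
    have hS : ∀ b ∈ S, D j b = 0 := by
      intro b hb
      induction hb using Algebra.adjoin_induction with
      | mem b hb =>
        rcases hb with hb | ⟨i, hi, rfl⟩
        · exact hDP j b hb
        · rw [hx, if_neg (by rintro rfl; exact hj hi)]
      | algebraMap r => exact (D j).map_algebraMap r
      | add a b _ _ ha hb => rw [map_add, ha, hb, add_zero]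
      | mul a b _ _ ha hb => rw [(D j).leibniz, ha, hb, smul_zero, smul_zero, add_zero]
    have hsup : Algebra.adjoin k (P ∪ x '' (insert j s : Finset ι)) =
        S ⊔ Algebra.adjoin k {x j} := by
      rw [hSdef, ← Algebra.adjoin_union, Finset.coe_insert, Set.image_insert_eq,
        Set.union_assoc, Set.union_singleton]
    rw [hsup] at ha
    have h := (D j).pow_mul_mem_of_apply_eq_zero (p := p) S hS (fun a => hPS (hP a)) (hPS hg)
      (by rw [hx, if_pos rfl]) ha (hDa j (Finset.mem_insert_self j s))
    rw [pow_add, mul_assoc]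
    refine hN _ h fun i hi => ?_
    rw [(D i).leibniz, hDa i (Finset.mem_insert_of_mem hi), (D i).leibniz_pow, hDP i g hg]
    simp

end Coefficients

theorem Module.exists_pow_mem_annihilator_of_tensorProduct_self {R Q : Type*} [CommRing R]
    [AddCommGroup Q] [Module R Q] [Module.Finite R Q] {u : R}
    (hu : u ∈ Module.annihilator R (Q ⊗[R] Q)) : ∃ n : ℕ, u ^ n ∈ Module.annihilator R Q := by
  change u ∈ (Module.annihilator R Q).radical
  rw [Ideal.radical_eq_sInf, Submodule.mem_sInf]
  rintro P ⟨hP, hprime⟩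
  have hsupp : (⟨P, hprime⟩ : PrimeSpectrum R) ∈ Module.support R (Q ⊗[R] Q) := by
    rw [Module.mem_support_iff_nontrivial_residueField_tensorProduct]
    have h := (Module.mem_support_iff_of_finite (R := R) (M := Q) (p := ⟨P, hprime⟩)).mpr hP
    rw [Module.mem_support_iff_nontrivial_residueField_tensorProduct] at h
    let K := Ideal.ResidueField P
    have e : K ⊗[R] (Q ⊗[R] Q) ≃ₗ[K] (K ⊗[R] Q) ⊗[K] (K ⊗[R] Q) :=
      TensorProduct.AlgebraTensorModule.distribBaseChange R K Q Q
    have : Nontrivial ((K ⊗[R] Q) ⊗[K] (K ⊗[R] Q)) := inferInstance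
    exact e.toEquiv.nontrivial
  exact Module.mem_support_iff_of_finite.mp hsupp hu

/-- If `A` is a finite algebra over a subring `S` such that every element of `A` has its `p`-th
power in `S` and `h` annihilates `Ω[A⁄S]`, then a power of `h` maps `A` into `S`. -/
theorem exists_pow_mul_mem_range_of_smul_kaehlerDifferential {S A : Type*} [CommRing S]
    [CommRing A] [Algebra S A] [Module.Finite S A] {p : ℕ} [Fact p.Prime] [CharP A p]
    (hpow : ∀ a : A, a ^ p ∈ (algebraMap S A).range) {h : A}
    (hΩ : ∀ a : A, h • KaehlerDifferential.D S A a = 0) :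
    ∃ N : ℕ, ∀ a : A, h ^ N * a ∈ (algebraMap S A).range := by
  classical
  let I := KaehlerDifferential.ideal S A
  have hp : (p : A ⊗[S] A) = 0 := by
    rw [← map_natCast (algebraMap A (A ⊗[S] A)), CharP.cast_eq_zero, map_zero]
  have hspan : Ideal.span (Set.range fun a : A => (1 : A) ⊗ₜ[S] a - a ⊗ₜ[S] (1 : A)) = I :=
    KaehlerDifferential.span_range_eq_ideal S A
  have hnil : IsNilpotent I := by
    rw [Ideal.FG.isNilpotent_iff_le_nilradical (KaehlerDifferential.ideal_fg S A)]
    change I ≤ _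
    rw [← hspan, Ideal.span_le]
    rintro _ ⟨a, rfl⟩
    refine ⟨p, ?_⟩
    rw [Ideal.zero_eq_bot, Ideal.mem_bot]
    obtain ⟨s, hs⟩ := hpow a
    rcases subsingleton_or_nontrivial (A ⊗[S] A) with hsub | hnt
    · exact Subsingleton.elim _ _
    have : CharP (A ⊗[S] A) p := (CharP.charP_iff_prime_eq_zero Fact.out).mpr hp
    rw [sub_pow_char, Algebra.TensorProduct.tmul_pow, Algebra.TensorProduct.tmul_pow, one_pow,
      ← hs, Algebra.algebraMap_eq_smul_one, TensorProduct.tmul_smul, TensorProduct.smul_tmul',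
      sub_self]
  have hI : Ideal.span {h ⊗ₜ[S] (1 : A)} * I ≤ I ^ 2 := by
    rw [← hspan, Ideal.span_mul_span', Ideal.span_le, hspan]
    rintro _ ⟨_, rfl, _, ⟨a, rfl⟩, rfl⟩
    let d : I := ⟨_, KaehlerDifferential.one_smul_sub_smul_one_mem_ideal S a⟩
    have hd : KaehlerDifferential.fromIdeal S A (h ⊗ₜ[S] (1 : A) • d) = 0 := by
      rw [map_smul, ← hΩ a]
      exact algebraMap_smul (A ⊗[S] A) h (KaehlerDifferential.D S A a)
    have h2 : h ⊗ₜ[S] (1 : A) * ((1 : A) ⊗ₜ[S] a - a ⊗ₜ[S] (1 : A)) ∈ I ^ 2 :=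
      (Ideal.toCotangent_eq_zero I (h ⊗ₜ[S] (1 : A) • d)).mp hd
    simpa using h2
  have hIn : ∀ n : ℕ, Ideal.span {h ⊗ₜ[S] (1 : A)} ^ n * I ≤ I ^ (n + 1) := by
    intro n
    induction n with
    | zero => simp
    | succ n ih =>
      calc _ = Ideal.span {h ⊗ₜ[S] (1 : A)} * (Ideal.span {h ⊗ₜ[S] (1 : A)} ^ n * I) := by ring
        _ ≤ Ideal.span {h ⊗ₜ[S] (1 : A)} * I ^ (n + 1) := Ideal.mul_mono_right ih
        _ = (Ideal.span {h ⊗ₜ[S] (1 : A)} * I) * I ^ n := by ring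
        _ ≤ I ^ 2 * I ^ n := Ideal.mul_mono_left hI
        _ = _ := by ring
  obtain ⟨n, hn⟩ := hnil
  have hn' : ∀ a : A, (h ^ n) ⊗ₜ[S] (1 : A) * ((1 : A) ⊗ₜ[S] a - a ⊗ₜ[S] (1 : A)) = 0 := by
    intro a
    have h1 : (h ^ n) ⊗ₜ[S] (1 : A) * ((1 : A) ⊗ₜ[S] a - a ⊗ₜ[S] (1 : A)) ∈ I ^ (n + 1) := by
      refine hIn n (Ideal.mul_mem_mul ?_ ?_)
      · rw [Ideal.span_singleton_pow, Algebra.TensorProduct.tmul_pow, one_pow]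
        exact Ideal.mem_span_singleton_self _
      · exact KaehlerDifferential.one_smul_sub_smul_one_mem_ideal S a
    rw [pow_succ, hn] at h1
    simpa using h1
  obtain ⟨u, hu⟩ := hpow (h ^ n)
  have hu' : ∀ a b : A, u • (a ⊗ₜ[S] b) = u • ((1 : A) ⊗ₜ[S] (a * b)) := by
    intro a b
    have h1 : (algebraMap S A u) ⊗ₜ[S] (1 : A) * ((1 : A) ⊗ₜ[S] a - a ⊗ₜ[S] (1 : A)) = 0 := by
      rw [hu, ← Nat.sub_add_cancel (Fact.out : p.Prime).pos, pow_succ,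
        ← one_mul (1 : A), ← Algebra.TensorProduct.tmul_mul_tmul, one_mul, mul_assoc, hn',
        mul_zero]
    have h2 := congrArg (· * ((1 : A) ⊗ₜ[S] b)) h1
    simp only [mul_sub, Algebra.TensorProduct.tmul_mul_tmul, sub_mul, one_mul, mul_one,
      zero_mul, sub_eq_zero] at h2
    rw [TensorProduct.smul_tmul', TensorProduct.smul_tmul', Algebra.smul_def, Algebra.smul_def,
      mul_one, ← h2]
  let Q := A ⧸ LinearMap.range (Algebra.linearMap S A)
  let π : A →ₗ[S] Q := Submodule.mkQ _
  have hQ : u ∈ Module.annihilator S (Q ⊗[S] Q) := by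
    rw [Module.mem_annihilator]
    intro t
    obtain ⟨t, rfl⟩ := TensorProduct.map_surjective (Submodule.mkQ_surjective _)
      (Submodule.mkQ_surjective _) t
    rw [← map_smul]
    induction t with
    | zero => simp
    | add a b ha hb => rw [smul_add, map_add, ha, hb, add_zero]
    | tmul a b =>
      rw [hu', map_smul, TensorProduct.map_tmul]
      have : π 1 = 0 := (Submodule.Quotient.mk_eq_zero _).mpr ⟨1, by simp⟩
      rw [this, TensorProduct.zero_tmul, smul_zero]
  obtain ⟨m, hm⟩ := Module.exists_pow_mem_annihilator_of_tensorProduct_self hQ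
  refine ⟨n * p * m, fun a => ?_⟩
  have h1 : π (u ^ m • a) = 0 := by rw [map_smul]; exact Module.mem_annihilator.mp hm _
  obtain ⟨s, hs⟩ := (Submodule.Quotient.mk_eq_zero _).mp h1
  refine ⟨s, ?_⟩
  rw [pow_mul, pow_mul, ← hu, ← map_pow, ← Algebra.smul_def]
  exact hs

/-- On a smooth algebra there is a finite family of elements `x i` such that, after
inverting elements `h s` generating the unit ideal, suitable subfamilies of the differentials
`dx i` generate `Ω[A⁄k]` and have dual derivations. -/
theorem exists_local_frames (k : Type*) {A : Type*} [Field k] [CommRing A] [Algebra k A]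
    [Module.Finite A Ω[A⁄k]] [Module.Projective A Ω[A⁄k]] :
    ∃ (n : ℕ) (x : Fin n → A) (h : Finset (Fin n) → A)
      (D : Finset (Fin n) → Fin n → Derivation k A A),
      Ideal.span (Set.range h) = ⊤ ∧ ∀ s,
        (∀ i, ∀ j ∈ s, D s i (x j) = if i = j then h s else 0) ∧
        ∀ a, h s • KaehlerDifferential.D k A a ∈
          Submodule.span A ((fun i => KaehlerDifferential.D k A (x i)) '' s) := by
  obtain ⟨n, x, hx⟩ : ∃ (n : ℕ) (x : Fin n → A),
      Submodule.span A (Set.range fun i => KaehlerDifferential.D k A (x i)) = ⊤ := by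
    have hfg : (Submodule.span A (Set.range (KaehlerDifferential.D k A))).FG := by
      rw [KaehlerDifferential.span_range_derivation]
      exact Module.Finite.fg_top
    obtain ⟨t, ht, hspan⟩ := (Submodule.fg_span_iff_fg_span_finset_subset _).mp hfg
    choose y hy using fun i : t => ht i.2
    refine ⟨t.card, y ∘ t.equivFin.symm, ?_⟩
    rw [KaehlerDifferential.span_range_derivation] at hspan
    rw [hspan]
    congr 1
    simp only [Function.comp_apply, hy]
    rw [← Function.comp_def Subtype.val, t.equivFin.symm.surjective.range_comp, Subtype.range_coe]
  let d := KaehlerDifferential.D k A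
  let π : (Fin n → A) →ₗ[A] Ω[A⁄k] := Fintype.linearCombination A fun i => d (x i)
  obtain ⟨σ, hσ⟩ := π.exists_rightInverse_of_surjective (by
    rw [← hx]; exact Fintype.range_linearCombination A _)
  let E : Fin n → Derivation k A A := fun i => ((LinearMap.proj i).comp σ).compDer d
  have hE : ∀ a, ∑ i, E i a • d (x i) = d a := fun a => LinearMap.congr_fun hσ (d a)
  let e : Matrix (Fin n) (Fin n) A := .of fun j i => E i (x j)
  let f : Matrix (Fin n) (Fin n) A := 1 - e
  let B : Finset (Fin n) → Matrix (Fin n) (Fin n) A := fun s =>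
    .of fun i => if i ∈ s then e i else f i
  refine ⟨n, x, fun s => (B s).det, fun s i => ∑ l, (B s).adjugate l i • E l, ?_, fun s => ⟨?_, ?_⟩⟩
  · rw [Ideal.eq_top_iff_one]
    have h1 : (1 : A) = ∑ s, (B s).det := by
      have := (Matrix.detRowAlternating (n := Fin n) (R := A)).map_add_univ e f
      rw [← Matrix.det_one (n := Fin n) (R := A), ← add_sub_cancel e 1]
      exact this
    rw [h1]
    exact Ideal.sum_mem _ fun s _ => Ideal.subset_span ⟨s, rfl⟩
  · intro i j hj
    have h1 := congrFun (congrFun (B s).mul_adjugate j) i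
    rw [Matrix.mul_apply, Matrix.smul_apply, Matrix.one_apply] at h1
    rw [← Derivation.coeFnAddMonoidHom_apply, map_sum, Finset.sum_apply]
    simp only [Derivation.coeFnAddMonoidHom_apply, Derivation.smul_apply, smul_eq_mul]
    have hB : ∀ l, B s j l = E l (x j) := fun l => by
      simp [B, e, hj]
    simp only [hB, smul_eq_mul, mul_ite, mul_one, mul_zero] at h1
    simp only [mul_comm _ (E _ _), h1, eq_comm]
  · intro a
    have hB : ∀ i, ∑ j, B s i j • d (x j) = if i ∈ s then d (x i) else 0 := by
      intro i
      split_ifs with hi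
      · rw [← hE (x i)]
        simp [B, e, hi]
      · simp [B, f, e, hi, sub_smul, hE, Matrix.one_apply]
    have hx : ∀ l, (B s).det • d (x l) ∈ Submodule.span A ((fun i => d (x i)) '' s) := by
      intro l
      have h1 : (B s).det • d (x l) = ∑ i, (B s).adjugate l i • ∑ j, B s i j • d (x j) := by
        simp only [Finset.smul_sum, smul_smul]
        rw [Finset.sum_comm]
        simp only [← Finset.sum_smul, ← Matrix.mul_apply, Matrix.adjugate_mul]
        simp [Matrix.one_apply]
      rw [h1]
      refine Submodule.sum_mem _ fun i _ => Submodule.smul_mem _ _ ?_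
      rw [hB]
      split_ifs with hi
      · exact Submodule.subset_span ⟨i, hi, rfl⟩
      · exact Submodule.zero_mem _
    change (B s).det • d a ∈ _
    rw [← hE a, Finset.smul_sum]
    refine Submodule.sum_mem _ fun i _ => ?_
    rw [smul_comm]
    exact Submodule.smul_mem _ _ (hx i)

theorem Derivation.apply_pow_char {k A : Type*} [Field k] [CommRing A] [Algebra k A] {p : ℕ}
    [CharP k p] (D : Derivation k A A) (a : A) : D (a ^ p) = 0 := by
  rw [D.leibniz_pow, ← Nat.cast_smul_eq_nsmul k, CharP.cast_eq_zero, zero_smul]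

theorem Derivation.mul_apply_eq_zero_of_smul_mem_span {k A ι : Type*} [CommRing k] [CommRing A]
    [Algebra k A] {x : ι → A} {h : A}
    (hspan : ∀ a, h • KaehlerDifferential.D k A a ∈
      Submodule.span A (Set.range fun i => KaehlerDifferential.D k A (x i)))
    (E : Derivation k A A) (hE : ∀ i, E (x i) = 0) (a : A) : h * E a = 0 := by
  have h1 : Submodule.span A (Set.range fun i => KaehlerDifferential.D k A (x i)) ≤
      LinearMap.ker E.liftKaehlerDifferential := by
    rw [Submodule.span_le]
    rintro _ ⟨i, rfl⟩
    simp [hE]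
  simpa using h1 (hspan a)

section LocalFrame

variable {k A : Type*} [Field k] [CommRing A] [Algebra k A] {p : ℕ} [Fact p.Prime] [CharP k p]
  {ι : Type*} [DecidableEq ι] {x : ι → A} {h : A}

theorem Derivation.pow_smul_apply (D : Derivation k A A) {c : A} (hc : D c = 0) (n : ℕ) (a : A) :
    (((c • D : Derivation k A A) : A →ₗ[k] A) ^ n) a = c ^ n * ((D : A →ₗ[k] A) ^ n) a := by
  induction n with
  | zero => simp
  | succ n ih =>
    rw [pow_succ', Module.End.mul_apply, ih, pow_succ' (D : A →ₗ[k] A), Module.End.mul_apply]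
    simp only [Derivation.coeFn_coe, Derivation.smul_apply, Derivation.leibniz,
      Derivation.leibniz_pow, hc, smul_eq_mul]
    simp only [mul_zero, smul_zero, add_zero]
    ring

/-- A dual frame up to a factor can be rescaled to a commuting one with vanishing `p`-th powers. -/
theorem exists_commuting_derivations [Nontrivial A] {D₀ : ι → Derivation k A A}
    (hD₀ : ∀ i j, D₀ i (x j) = if i = j then h else 0)
    (hspan : ∀ a, h • KaehlerDifferential.D k A a ∈
      Submodule.span A (Set.range fun i => KaehlerDifferential.D k A (x i))) :
    ∃ D : ι → Derivation k A A, (∀ i j, D i (x j) = if i = j then (h ^ 2) ^ p else 0) ∧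
      (∀ i j, ⁅D i, D j⁆ = 0) ∧ ∀ i, (D i : A →ₗ[k] A) ^ p = 0 := by
  have hp : p.Prime := Fact.out
  have hh : h ^ p = h ^ (p - 1) * h := by rw [← pow_succ, Nat.sub_add_cancel hp.pos]
  let D' : ι → Derivation k A A := fun i => h ^ (p - 1) • D₀ i
  have hD' : ∀ i j, D' i (x j) = if i = j then h ^ p else 0 := by
    intro i j
    simp only [D', Derivation.smul_apply, hD₀, smul_eq_mul, mul_ite, mul_zero, hh]
  have hDp : ∀ (E : Derivation k A A), E (h ^ p) = 0 := fun E => E.apply_pow_char h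
  have hzero : ∀ E : Derivation k A A, (∀ i, E (x i) = 0) → ∀ a, h ^ p * E a = 0 := by
    intro E hE a
    rw [hh, mul_assoc, E.mul_apply_eq_zero_of_smul_mem_span hspan hE, mul_zero]
  refine ⟨fun i => h ^ p • D' i, ?_, ?_, ?_⟩
  · intro i j
    simp only [Derivation.smul_apply, hD', smul_eq_mul, mul_ite, mul_zero]
    rw [← sq, pow_right_comm]
  · intro i j
    ext a
    have h1 := hzero ⁅D' i, D' j⁆ (fun l => by
      rw [Derivation.commutator_apply, hD', hD']; split_ifs <;> simp [hDp]) a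
    rw [Derivation.commutator_apply] at h1
    simp only [Derivation.commutator_apply, Derivation.smul_apply, Derivation.leibniz, hDp,
      smul_eq_mul, Derivation.coe_zero, Pi.zero_apply]
    linear_combination h ^ p * h1
  · intro i
    obtain ⟨Δ, hΔ⟩ := (D' i).exists_eq_pow_char p
    ext a
    rw [Derivation.pow_smul_apply _ (hDp _), ← hΔ, Derivation.coeFn_coe,
      ← Nat.sub_add_cancel hp.pos, pow_succ, mul_assoc, Nat.sub_add_cancel hp.pos, hzero,
      mul_zero, LinearMap.zero_apply]
    intro l
    obtain ⟨q, hq⟩ := Nat.exists_eq_add_of_le hp.two_le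
    rw [← Derivation.coeFn_coe, hΔ]
    simp only [hq, add_comm 2 q, pow_add, pow_two, Module.End.mul_apply, Derivation.coeFn_coe]
    rw [hD']
    split_ifs <;> simp [hDp]

/-- Elements annihilated by a dual frame are `p`-th powers up to a power of `h`. -/
theorem exists_pow_mul_mem_frobenius_range [Fintype ι] [PerfectField k] [CharP A p]
    [Algebra.FiniteType k A]
    (hspan : ∀ a, h • KaehlerDifferential.D k A a ∈
      Submodule.span A (Set.range fun i => KaehlerDifferential.D k A (x i)))
    {D : ι → Derivation k A A} (hD : ∀ i j, D i (x j) = if i = j then (h ^ 2) ^ p else 0) :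
    ∃ N : ℕ, ∀ a, (∀ i, D i a = 0) → ((h ^ 2) ^ p) ^ N * a ∈ (frobenius A p).range := by
  let P : Set A := Set.range (frobenius A p)
  let S := Algebra.adjoin k (P ∪ x '' (Finset.univ : Finset ι))
  have hP : ∀ a : A, a ^ p ∈ P := fun a => ⟨a, rfl⟩
  have hPS : P ⊆ S := Set.subset_union_left.trans Algebra.subset_adjoin
  have hpow : ∀ a : A, a ^ p ∈ (algebraMap S A).range := fun a => ⟨⟨_, hPS (hP a)⟩, rfl⟩
  have : Algebra.FiniteType S A := .of_restrictScalars_finiteType k S A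
  have : Algebra.IsIntegral S A := ⟨fun a =>
    IsIntegral.of_pow (Fact.out : p.Prime).pos (by
      obtain ⟨s, hs⟩ := hpow a
      rw [← hs]
      exact isIntegral_algebraMap)⟩
  have : Module.Finite S A := Algebra.IsIntegral.finite
  have hΩ : ∀ a : A, (h ^ 2) ^ p • KaehlerDifferential.D S A a = 0 := by
    intro a
    have h1 : Submodule.span A (Set.range fun i => KaehlerDifferential.D k A (x i)) ≤
        LinearMap.ker (KaehlerDifferential.map k S A A) := by
      rw [Submodule.span_le]
      rintro _ ⟨i, rfl⟩
      have hi : x i ∈ S := Algebra.subset_adjoin (Or.inr ⟨i, by simp, rfl⟩)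
      simpa using (KaehlerDifferential.D S A).map_algebraMap ⟨x i, hi⟩
    have h2 : h • KaehlerDifferential.D S A a = 0 := by simpa using h1 (hspan a)
    rw [← pow_mul, ← Nat.sub_add_cancel (Nat.mul_pos two_pos (Fact.out : p.Prime).pos), pow_succ,
      mul_smul, h2, smul_zero]
  obtain ⟨n, hn⟩ := exists_pow_mul_mem_range_of_smul_kaehlerDifferential hpow hΩ
  obtain ⟨N, hN⟩ := exists_pow_mul_mem_adjoin_of_apply_eq_zero (k := k) (p := p) (P := P) hP
    (by rintro i _ ⟨a, rfl⟩; exact (D i).apply_pow_char a) (hP (h ^ 2)) hD Finset.univ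
  have hadj : ∀ a ∈ Algebra.adjoin k P, a ∈ (frobenius A p).range := by
    intro a ha
    induction ha using Algebra.adjoin_induction with
    | mem a ha => exact ha
    | algebraMap r =>
      have : PerfectRing k p := PerfectField.toPerfectRing p
      obtain ⟨c, rfl⟩ := surjective_frobenius k p r
      exact ⟨algebraMap k A c, by simp [frobenius_def]⟩
    | add a b _ _ ha hb => exact add_mem ha hb
    | mul a b _ _ ha hb => exact mul_mem ha hb
  refine ⟨N + n, fun a ha => hadj _ ?_⟩
  rw [pow_add, mul_assoc]
  refine hN _ ?_ fun i _ => ?_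
  · obtain ⟨s, hs⟩ := hn a
    rw [← hs]
    exact s.2
  · rw [(D i).leibniz, (D i).leibniz_pow, (D i).apply_pow_char, ha i]
    simp

end LocalFrame

section Descent

variable {k A : Type u} [Field k] [CommRing A] [Algebra k A]
  {M : Type v} [AddCommGroup M] [Module k M] [Module A M] [IsScalarTower k A M]

/-- The pairs of operators on `A` and `M` that are compatible with the products `a • m`, `m ∈ H`. -/
def compatibleOperators (k A : Type*) {M : Type*} [CommRing k] [CommRing A] [Algebra k A]
    [AddCommGroup M] [Module k M] [Module A M] (H : AddSubgroup M) :
    Subring (Module.End k A × Module.End k M) where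
  carrier := {r | ∀ a, ∀ m ∈ H, r.2 (a • m) = r.1 a • m}
  one_mem' := fun _ _ _ => rfl
  mul_mem' := fun {r s} hr hs a m hm => by
    rw [Prod.snd_mul, Prod.fst_mul, Module.End.mul_apply, hs a m hm, hr _ m hm]; rfl
  zero_mem' := fun a m _ => by simp
  add_mem' := fun {r s} hr hs a m hm => by
    rw [Prod.snd_add, Prod.fst_add, LinearMap.add_apply, hs a m hm, hr _ m hm, LinearMap.add_apply,
      add_smul]
  neg_mem' := fun {r} hr a m hm => by
    rw [Prod.snd_neg, Prod.fst_neg, LinearMap.neg_apply, hr _ m hm, LinearMap.neg_apply, neg_smul]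

variable {p : ℕ} [Fact p.Prime] [CharP k p] [CharP A p]
  {nabla : Derivation k A A → Module.End k M}
  {ι : Type*} [Fintype ι] [DecidableEq ι] {x : ι → A} {h : A} {D : ι → Derivation k A A}

/-- An element annihilated by `∇` along a frame is horizontal up to a factor. -/
theorem smul_mem_horizontalSubmodule
    (hadd : ∀ D D' : Derivation k A A, nabla (D + D') = nabla D + nabla D')
    (hsmul : ∀ (a : A) (D : Derivation k A A) (m : M), nabla (a • D) m = a • nabla D m)
    (leibniz : ∀ (D : Derivation k A A) (a : A) (m : M),
      nabla D (a • m) = D a • m + a • nabla D m)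
    (hspan : ∀ a, h • KaehlerDifferential.D k A a ∈
      Submodule.span A (Set.range fun i => KaehlerDifferential.D k A (x i)))
    (hD : ∀ i j, D i (x j) = if i = j then (h ^ 2) ^ p else 0) {m : M}
    (hm : ∀ i, nabla (D i) m = 0) :
    ((h ^ 2) ^ p) ^ 2 • m ∈ horizontalSubmodule p M nabla leibniz := by
  intro E
  let ψ : Derivation k A A →ₗ[A] M :=
    { toFun := fun D => nabla D m
      map_add' := fun D D' => by rw [hadd, LinearMap.add_apply]
      map_smul' := fun a D => hsmul a D m }
  let F : Derivation k A A := (h ^ 2) ^ p • E - ∑ i, E (x i) • D i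
  have hF : h • F = 0 := by
    ext a
    rw [Derivation.smul_apply, smul_eq_mul, F.mul_apply_eq_zero_of_smul_mem_span hspan,
      Derivation.zero_apply]
    intro j
    rw [Derivation.sub_apply, ← Derivation.coeFnAddMonoidHom_apply (∑ i, _), map_sum,
      Finset.sum_apply]
    simp [hD, mul_comm]
  have h1 : h • (h ^ 2) ^ p • ψ E = 0 := by
    have h2 : ψ (h • F) = 0 := by rw [hF, map_zero]
    have h3 : ∀ i, ψ (D i) = 0 := hm
    simpa [F, h3] using h2
  have hE : E (((h ^ 2) ^ p) ^ 2) = 0 := by rw [E.leibniz_pow, E.apply_pow_char]; simp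
  rw [leibniz, hE, zero_smul, zero_add]
  change ((h ^ 2) ^ p) ^ 2 • ψ E = 0
  obtain ⟨c, hc⟩ : h ∣ (h ^ 2) ^ p := by
    rw [← pow_mul]
    exact dvd_pow_self h (Nat.mul_pos two_pos (Fact.out : p.Prime).pos).ne'
  rw [sq, mul_smul]
  nth_rewrite 1 [hc]
  rw [mul_comm, mul_smul, h1, smul_zero]

/-- Frobenius descent up to a power of `h`, for a dual frame up to the factor `h`. -/
theorem exists_pow_smul_descent [PerfectField k] [Algebra.FiniteType k A]
    (hadd : ∀ D D' : Derivation k A A, nabla (D + D') = nabla D + nabla D')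
    (hsmul : ∀ (a : A) (D : Derivation k A A) (m : M), nabla (a • D) m = a • nabla D m)
    (leibniz : ∀ (D : Derivation k A A) (a : A) (m : M),
      nabla D (a • m) = D a • m + a • nabla D m)
    (flat : ∀ D D' : Derivation k A A,
      nabla ⁅D, D'⁆ = nabla D * nabla D' - nabla D' * nabla D)
    (pcurv : ∀ D D' : Derivation k A A, (D' : A →ₗ[k] A) = (D : A →ₗ[k] A) ^ p →
      nabla D ^ p = nabla D')
    {D₀ : ι → Derivation k A A} (hD₀ : ∀ i j, D₀ i (x j) = if i = j then h else 0)
    (hspan : ∀ a, h • KaehlerDifferential.D k A a ∈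
      Submodule.span A (Set.range fun i => KaehlerDifferential.D k A (x i))) :
    ∃ N : ℕ,
      (∀ m, h ^ N • m ∈ LinearMap.range
        (LinearMap.liftBaseChange A (horizontalSubmodule p M nabla leibniz).subtype)) ∧
      ∀ t, LinearMap.liftBaseChange A (horizontalSubmodule p M nabla leibniz).subtype t = 0 →
        h ^ N • t = 0 := by
  have : Nontrivial A := CharP.nontrivial_of_char_ne_one (R := A) (Fact.out : p.Prime).ne_one
  obtain ⟨D, hD, hbr, hpow⟩ := exists_commuting_derivations (p := p) hD₀ hspan
  obtain ⟨N₁, hN₁⟩ := exists_pow_mul_mem_frobenius_range hspan hD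
  let H := horizontalSubmodule p M nabla leibniz
  set g := (h ^ 2) ^ p with hg
  have hDg : ∀ i, D i g = 0 := fun i => (D i).apply_pow_char _
  have hnabla0 : nabla 0 = 0 := by simpa using hadd 0 0
  let μ : A →+* Module.End k A × Module.End k M :=
    RingHom.prod (Algebra.lmul k A) (Algebra.lsmul k k M : A →ₐ[k] Module.End k M)
  let T : ι → Module.End k A × Module.End k M := fun i => (D i, nabla (D i))
  obtain ⟨N, hN⟩ := exists_pow_mem_annihilatedSpan (p := p) (μ := μ) (T := T) (x := x) (g := g)
    (S := compatibleOperators k A H.toAddSubgroup)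
    (by rw [← map_natCast (algebraMap k (Module.End k A × Module.End k M)), CharP.cast_eq_zero,
      map_zero])
    (fun a b m _ => by simp [μ, mul_smul])
    (fun i a m hm => by simp [T, leibniz, show nabla (D i) m = 0 from hm (D i)])
    (fun i j => by
      refine Prod.ext (LinearMap.ext fun a => ?_) (LinearMap.ext fun m => ?_)
      · split_ifs with hij <;> simp [T, μ, hD, hij, mul_comm, add_comm]
      · split_ifs with hij <;> simp [T, μ, hD, hij, leibniz, add_comm])
    (fun i => by
      refine Prod.ext (LinearMap.ext fun a => ?_) (LinearMap.ext fun m => ?_)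
      · simp [T, μ, hDg]
      · simp [T, μ, hDg, leibniz])
    (fun i j => by
      refine Prod.ext (LinearMap.ext fun a => ?_) ?_
      · exact sub_eq_zero.mp (by
          simpa [T, Derivation.commutator_apply] using DFunLike.congr_fun (hbr i j) a)
      · have h1 := flat (D i) (D j)
        rw [hbr, hnabla0] at h1
        exact (sub_eq_zero.mp h1.symm))
    (fun i => Prod.ext (hpow i) (by
      rw [Prod.pow_snd, Prod.snd_zero, ← hnabla0]
      exact pcurv _ 0 (hpow i).symm))
    Finset.univ
  have hsurj : ∀ m, g ^ (2 + N) • m ∈ LinearMap.range (LinearMap.liftBaseChange A H.subtype) := by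
    intro m
    have key : ∀ r ∈ annihilatedSpan (compatibleOperators k A H.toAddSubgroup) μ T Finset.univ,
        g ^ 2 • r.2 m ∈ LinearMap.range (LinearMap.liftBaseChange A H.subtype) := by
      intro r hr
      induction hr using AddSubgroup.closure_induction with
      | mem r hr =>
        obtain ⟨c, Q, -, hT, rfl⟩ := hr
        have h1 : g ^ 2 • Q.2 m ∈ H := smul_mem_horizontalSubmodule hadd hsmul leibniz hspan hD
          fun i => LinearMap.congr_fun (congrArg Prod.snd (hT i (Finset.mem_univ i))) m
        refine ⟨c ⊗ₜ ⟨_, h1⟩, ?_⟩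
        rw [LinearMap.liftBaseChange_tmul]
        exact smul_comm c (g ^ 2) (Q.2 m)
      | zero => simp
      | add a b _ _ ha hb => rw [Prod.snd_add, LinearMap.add_apply, smul_add]; exact add_mem ha hb
      | neg a _ ha => rw [Prod.snd_neg, LinearMap.neg_apply, smul_neg]; exact neg_mem ha
    rw [pow_add, mul_smul]
    exact key _ hN
  have hinj : ∀ t, LinearMap.liftBaseChange A H.subtype t = 0 → g ^ (N₁ + N) • t = 0 := by
    intro t ht
    obtain ⟨s, rfl⟩ := TensorProduct.exists_finset t
    have hs : ∑ y ∈ s, y.1 • (y.2 : M) = 0 := by simpa using ht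
    have key : ∀ r ∈ annihilatedSpan (compatibleOperators k A H.toAddSubgroup) μ T Finset.univ,
        g ^ N₁ • ∑ y ∈ s, r.1 y.1 ⊗ₜ[(frobenius A p).range] y.2 = 0 := by
      intro r hr
      induction hr using AddSubgroup.closure_induction with
      | mem r hr =>
        obtain ⟨c, Q, hQ, hT, rfl⟩ := hr
        have h1 : ∀ a, g ^ N₁ * Q.1 a ∈ (frobenius A p).range := fun a => hN₁ _ fun i =>
          LinearMap.congr_fun (congrArg Prod.fst (hT i (Finset.mem_univ i))) a
        have h2 : ∀ y ∈ s, g ^ N₁ • (μ c * Q).1 y.1 ⊗ₜ[(frobenius A p).range] y.2 =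
            c ⊗ₜ ((⟨_, h1 y.1⟩ : (frobenius A p).range) • y.2) := by
          intro y _
          rw [← TensorProduct.smul_tmul, TensorProduct.smul_tmul']
          congr 1
          change g ^ N₁ * (c * Q.1 y.1) = g ^ N₁ * Q.1 y.1 * c
          ring
        rw [Finset.smul_sum, Finset.sum_congr rfl h2, ← TensorProduct.tmul_sum]
        have h3 : ∑ y ∈ s, (⟨_, h1 y.1⟩ : (frobenius A p).range) • y.2 = 0 := by
          refine Subtype.ext ?_
          have h4 : Q.2 (∑ y ∈ s, y.1 • (y.2 : M)) = ∑ y ∈ s, Q.1 y.1 • (y.2 : M) := by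
            rw [map_sum]
            exact Finset.sum_congr rfl fun y _ => hQ _ _ y.2.2
          rw [hs, map_zero] at h4
          have h5 : g ^ N₁ • ∑ y ∈ s, Q.1 y.1 • (y.2 : M) = 0 := by rw [← h4, smul_zero]
          simpa [Finset.smul_sum, smul_smul, Subring.smul_def] using h5
        rw [h3, TensorProduct.tmul_zero]
      | zero => simp
      | add a b _ _ ha hb =>
        simp only [Prod.fst_add, LinearMap.add_apply, TensorProduct.add_tmul,
          Finset.sum_add_distrib, smul_add, ha, hb, add_zero]
      | neg a _ ha =>
        simp only [Prod.fst_neg, LinearMap.neg_apply, TensorProduct.neg_tmul,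
          Finset.sum_neg_distrib, smul_neg, ha, neg_zero]
    rw [pow_add, mul_smul, Finset.smul_sum]
    exact key _ hN
  have hgh : ∀ n, h ^ (2 * p * n) = g ^ n := fun n => by rw [pow_mul, pow_mul]
  refine ⟨2 * p * (N₁ + 2 + N), fun m => ?_, fun t ht => ?_⟩
  · rw [hgh, add_assoc, pow_add, mul_smul]
    exact Submodule.smul_mem _ _ (hsurj m)
  · rw [hgh, add_right_comm, pow_add, mul_comm, mul_smul, hinj t ht, smul_zero]

end Descent

/-- **Affine Cartier–Frobenius descent, descent direction.**
Let `k` be a perfect field of characteristic `p`, `A` a smooth `k`-algebra (of characteristic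
`p`), and `M` an `A`-module equipped with a flat connection `∇` of vanishing `p`-curvature.
Then the natural `A`-linear map `A ⊗_{A^p} M^∇ → M` sending `a ⊗ m` to `a • m` is bijective. -/
theorem frobenius_descent_bijective
    {k A : Type u} [Field k] [PerfectField k] (p : ℕ) [Fact p.Prime] [CharP k p]
    [CommRing A] [Algebra k A] [Algebra.Smooth k A] [CharP A p]
    (M : Type v) [AddCommGroup M] [Module k M] [Module A M] [IsScalarTower k A M]
    (nabla : Derivation k A A → Module.End k M)
    (hadd : ∀ D D' : Derivation k A A, nabla (D + D') = nabla D + nabla D')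
    (hsmul : ∀ (a : A) (D : Derivation k A A) (m : M), nabla (a • D) m = a • nabla D m)
    (leibniz : ∀ (D : Derivation k A A) (a : A) (m : M),
      nabla D (a • m) = D a • m + a • nabla D m)
    (flat : ∀ D D' : Derivation k A A,
      nabla ⁅D, D'⁆ = nabla D * nabla D' - nabla D' * nabla D)
    (pcurv : ∀ D D' : Derivation k A A, (D' : A →ₗ[k] A) = (D : A →ₗ[k] A) ^ p →
      nabla D ^ p = nabla D') :
    Function.Bijective
      (LinearMap.liftBaseChange A
        (horizontalSubmodule p M nabla leibniz).subtype) := by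
  have hfin : Algebra.FiniteType k A :=
    have : Algebra.FinitePresentation k A := Algebra.Smooth.finitePresentation
    inferInstance
  obtain ⟨n, x, h, D, hh, hfr⟩ := exists_local_frames k (A := A)
  have hloc : ∀ s, ∃ N : ℕ, _ := fun s : Finset (Fin n) =>
    exists_pow_smul_descent (p := p) (ι := s) (x := fun i : s => x i) (h := h s)
      hadd hsmul leibniz flat pcurv (D₀ := fun i : s => D s i)
      (fun i j => ((hfr s).1 i j j.2).trans (by simp only [Subtype.coe_inj]))
      (fun a => by simpa [Set.image_eq_range] using (hfr s).2 a)
  choose N hsurj hinj using hloc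
  refine ⟨(injective_iff_map_eq_zero _).mpr fun t ht => ?_, fun m => ?_⟩
  · exact (Submodule.mem_bot A).mp <| Submodule.mem_of_span_eq_top_of_smul_pow_mem _ _ hh _ <| by
      rintro ⟨_, s, rfl⟩
      exact ⟨N s, (Submodule.mem_bot A).mpr (hinj s t ht)⟩
  · exact Submodule.mem_of_span_eq_top_of_smul_pow_mem (LinearMap.range _) _ hh m <| by
      rintro ⟨_, s, rfl⟩
      exact ⟨N s, hsurj s m⟩
end

section
/- Affine Cartier–Frobenius descent (pullback direction of Theorem B.1): let N be a module over the subring A^p. Each k-derivation D of A is A^p-linear and hence induces an additive endomorphism D ⊗ id of A ⊗_{A^p} N. Then the map N → A ⊗_{A^p} N sending n to 1 ⊗ n is injective, and its image equals {x ∈ A ⊗_{A^p} N : (D ⊗ id)(x) = 0 for every k-derivation D of A}. -/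
/-!
Affine Cartier–Frobenius descent (pullback direction): for an `A^p`-module `N`, the map
`N → A ⊗_{A^p} N`, `n ↦ 1 ⊗ n`, is injective with image the set of elements killed by
`D ⊗ id` for every `k`-derivation `D` of `A`.
-/

universe u v

open scoped TensorProduct

/-- A `k`-derivation of `A` kills `p`-th powers, hence is linear over the subring
`A^p = (frobenius A p).range`. -/
noncomputable def Derivation.apLinear {k A : Type u} [Field k] [CommRing A] [Algebra k A]
    (p : ℕ) [Fact p.Prime] [CharP A p] (D : Derivation k A A) :
    A →ₗ[(frobenius A p).range] A where
  toFun := D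
  map_add' := map_add D
  map_smul' := by
    rintro ⟨c, b, rfl⟩ a
    have hD : D (frobenius A p b) = 0 := by
      rw [frobenius_def, Derivation.leibniz_pow]
      simp [nsmul_eq_mul, CharP.cast_eq_zero A p]
    show D ((⟨frobenius A p b, _⟩ : (frobenius A p).range) • a) = _
    rw [Subring.smul_def, Subring.smul_def, smul_eq_mul, Derivation.leibniz]
    simp [hD]

/-- A finite, unramified and purely inseparable (of height one) ring map is surjective. -/
theorem Algebra.FormallyUnramified.surjective_algebraMap_of_pow_mem {B A : Type*} [CommRing B]
    [CommRing A] [Algebra B A] [Module.Finite B A] (p : ℕ) [Fact p.Prime] [CharP A p]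
    [Algebra.FormallyUnramified B A] (h : ∀ a : A, a ^ p ∈ (algebraMap B A).range) :
    Function.Surjective (algebraMap B A) := by
  rw [← Algebra.isEpi_iff_surjective_algebraMap_of_finite]
  have hfg := KaehlerDifferential.ideal_fg B A
  have hid : IsIdempotentElem (KaehlerDifferential.ideal B A) :=
    (Ideal.cotangent_subsingleton_iff _).mp
      (inferInstanceAs (Subsingleton Ω[A⁄B]))
  have hinj : Function.Injective (algebraMap A (A ⊗[B] A)) := by
    refine Function.LeftInverse.injective (g := Algebra.TensorProduct.lmul' B) fun a ↦ ?_
    simp [Algebra.TensorProduct.algebraMap_apply]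
  have : CharP (A ⊗[B] A) p := charP_of_injective_algebraMap hinj p
  have hnil : IsNilpotent (KaehlerDifferential.ideal B A) := by
    rw [Ideal.FG.isNilpotent_iff_le_nilradical hfg, ← KaehlerDifferential.span_range_eq_ideal,
      Ideal.span_le]
    rintro _ ⟨s, rfl⟩
    refine ⟨p, ?_⟩
    obtain ⟨b, hb⟩ := h s
    dsimp only
    rw [sub_pow_char, Algebra.TensorProduct.tmul_pow, Algebra.TensorProduct.tmul_pow, ← hb,
      one_pow, Algebra.algebraMap_eq_smul_one, TensorProduct.smul_tmul, sub_self]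
    exact zero_mem _
  have hbot : KaehlerDifferential.ideal B A = ⊥ := by
    obtain ⟨n, hn⟩ := hnil
    have := hid.pow_succ_eq n
    rw [pow_succ, hn, zero_mul] at this
    exact this.symm
  refine (Algebra.isEpi_iff_forall_one_tmul_eq B A).mpr fun a ↦ ?_
  have := KaehlerDifferential.one_smul_sub_smul_one_mem_ideal B a
  rw [hbot, Ideal.mem_bot] at this
  exact sub_eq_zero.mp this

/-- If the `dx_i` span `Ω[A⁄R]` and `A^p ⊆ R`, then the `x_i` generate `A` over `R`. -/
theorem Algebra.adjoin_range_eq_top_of_span_kaehlerDifferential {R A ι : Type*} [CommRing R]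
    [CommRing A] [Algebra R A] [Module.Finite R A] (p : ℕ) [Fact p.Prime] [CharP A p]
    (h : ∀ a : A, a ^ p ∈ (algebraMap R A).range) (x : ι → A)
    (hx : Submodule.span A (Set.range fun i ↦ KaehlerDifferential.D R A (x i)) = ⊤) :
    Algebra.adjoin R (Set.range x) = ⊤ := by
  set B := Algebra.adjoin R (Set.range x) with hB
  have : Module.Finite B A := Module.Finite.of_restrictScalars_finite R B A
  have : Subsingleton Ω[A⁄B] := by
    have h0 : KaehlerDifferential.map R B A A = 0 := by
      refine LinearMap.ext_on hx ?_
      rintro _ ⟨i, rfl⟩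
      rw [KaehlerDifferential.map_D]
      exact (KaehlerDifferential.D B A).map_algebraMap
        (⟨x i, Algebra.subset_adjoin ⟨i, rfl⟩⟩ : B)
    refine subsingleton_of_forall_eq 0 fun y ↦ ?_
    obtain ⟨z, rfl⟩ := KaehlerDifferential.map_surjective R B A y
    simp [h0]
  have : Algebra.FormallyUnramified B A := ⟨this⟩
  have hs := Algebra.FormallyUnramified.surjective_algebraMap_of_pow_mem (B := B) (A := A) p
    fun a ↦ by
      obtain ⟨r, hr⟩ := h a
      exact ⟨algebraMap R B r, hr⟩
  refine Algebra.eq_top_iff.mpr fun a ↦ ?_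
  obtain ⟨b, rfl⟩ := hs a
  exact b.2

/-- If `dx_i` is a basis of `Ω[A⁄R]` in characteristic `p`, then up to operators factoring through
`d` the identity of `A` is homotopic to an operator that fixes or kills each monomial in the `x_i`,
and only fixes those whose exponents at `s` are divisible by `p`. -/
theorem KaehlerDifferential.exists_homotopy_on_monomials {R A ι : Type*} [CommRing R]
    [CommRing A] [Algebra R A] (p : ℕ) [Fact p.Prime] [CharP A p]
    (x : ι → A) (b : Module.Basis ι A Ω[A⁄R])
    (hb : ∀ i, b i = KaehlerDifferential.D R A (x i)) (s : Finset ι) :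
    ∃ (T : A →ₗ[R] A) (Q : Ω[A⁄R] →ₗ[R] A),
      (∀ a, a = T a + Q (KaehlerDifferential.D R A a)) ∧
      ∀ α : ι →₀ ℕ, T (α.prod fun i n ↦ x i ^ n) = 0 ∨
        T (α.prod fun i n ↦ x i ^ n) = (α.prod fun i n ↦ x i ^ n) ∧ ∀ i ∈ s, p ∣ α i := by
  classical
  induction s using Finset.induction_on with
  | empty => exact ⟨LinearMap.id, 0, by simp, by simp⟩
  | insert i s _ ih =>
    obtain ⟨T, Q, h1, h2⟩ := ih
    -- the Euler operator `x i ∂ i`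
    let c : Ω[A⁄R] →ₗ[R] A := (x i • b.coord i).restrictScalars R
    let E : Derivation R A A := (x i • b.coord i).compDer (KaehlerDifferential.D R A)
    have hE : ∀ a, E a = c (KaehlerDifferential.D R A a) := fun _ ↦ rfl
    have hEx : ∀ j, E (x j) = if j = i then x j else 0 := by
      intro j
      rw [hE, ← hb]
      by_cases hij : j = i
      · subst hij; simp [c]
      · simp [c, hij]
    have hEm : ∀ α : ι →₀ ℕ, E (α.prod fun i n ↦ x i ^ n) =
        (α i : A) * (α.prod fun i n ↦ x i ^ n) := by
      intro α
      induction α using Finsupp.induction_linear with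
      | zero => simp
      | add f g hf hg =>
        rw [Finsupp.prod_add_index' (by simp) (by simp [pow_add]), E.leibniz, hf, hg]
        simp only [smul_eq_mul, Finsupp.add_apply, Nat.cast_add]
        ring
      | single j n =>
        rw [Finsupp.prod_single_index (by simp), E.leibniz_pow, hEx]
        by_cases hij : j = i
        · subst hij
          rcases n with _ | n
          · simp
          · simp [pow_succ]
        · simp [hij]
    let L : A →ₗ[R] A := E
    have hp : p - 1 = (p - 2) + 1 := by have := (Fact.out : p.Prime).two_le; omega
    refine ⟨T ∘ₗ (LinearMap.id - L ^ (p - 1)), Q + T ∘ₗ (L ^ (p - 2)) ∘ₗ c, ?_, ?_⟩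
    · intro a
      have : (L ^ (p - 1)) a = (L ^ (p - 2)) (c (KaehlerDifferential.D R A a)) := by
        rw [hp, pow_succ]; rfl
      simp only [LinearMap.comp_apply, LinearMap.sub_apply, LinearMap.add_apply, map_sub, this,
        LinearMap.id_apply]
      conv_lhs => rw [h1 a]
      abel
    · intro α
      set m := α.prod fun i n ↦ x i ^ n
      have hL : ∀ n, (L ^ n) m = ((α i) ^ n : ℕ) • m := by
        intro n
        induction n with
        | zero => simp
        | succ n ihn =>
          have : L m = (α i : ℕ) • m := (hEm α).trans (nsmul_eq_mul _ _).symm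
          rw [pow_succ', Module.End.mul_apply, ihn, map_nsmul, this, ← mul_smul, pow_succ]
      have hT : (T ∘ₗ (LinearMap.id - L ^ (p - 1))) m = T m - (α i ^ (p - 1)) • T m := by
        rw [LinearMap.comp_apply, LinearMap.sub_apply, hL, map_sub, map_nsmul, LinearMap.id_apply]
      rw [hT]
      by_cases hd : p ∣ α i
      · have h0 : (α i ^ (p - 1)) • T m = 0 := by
          rw [nsmul_eq_mul, (CharP.cast_eq_zero_iff A p _).mpr
            (dvd_pow hd (by rw [hp]; simp)), zero_mul]
        rw [h0, sub_zero]
        refine (h2 α).imp_right fun h ↦ ⟨h.1, ?_⟩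
        simpa [hd] using h.2
      · left
        have h1' : ((α i ^ (p - 1) : ℕ) : A) = 1 := by
          have hz : ((α i : ℕ) : ZMod p) ≠ 0 := by
            rwa [Ne, ZMod.natCast_eq_zero_iff]
          have := congrArg (ZMod.castHom (dvd_refl p) A) (ZMod.pow_card_sub_one_eq_one hz)
          simpa using this
        rw [nsmul_eq_mul, h1', one_mul, sub_self]

/-- If `A^p ⊆ R ⊆ A` and the `dx_i` form a basis of `Ω[A⁄R]`, then the complex
`0 → R → A → Ω[A⁄R]` admits an `R`-linear contracting homotopy at `A`. -/
theorem KaehlerDifferential.exists_homotopy_of_basis {R A ι : Type*} [CommRing R]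
    [CommRing A] [Algebra R A] [Module.Finite R A] (p : ℕ) [Fact p.Prime] [CharP A p]
    (h : ∀ a : A, a ^ p ∈ (algebraMap R A).range)
    (hinj : Function.Injective (algebraMap R A)) [Finite ι]
    (x : ι → A) (b : Module.Basis ι A Ω[A⁄R])
    (hb : ∀ i, b i = KaehlerDifferential.D R A (x i)) :
    ∃ (π : A →ₗ[R] R) (Q : Ω[A⁄R] →ₗ[R] A),
      ∀ a, a = algebraMap R A (π a) + Q (KaehlerDifferential.D R A a) := by
  classical
  have := Fintype.ofFinite ι
  obtain ⟨T, Q, h1, h2⟩ := KaehlerDifferential.exists_homotopy_on_monomials p x b hb Finset.univ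
  have hadj : Algebra.adjoin R (Set.range x) = ⊤ := by
    refine Algebra.adjoin_range_eq_top_of_span_kaehlerDifferential p h x ?_
    rw [← b.span_eq]
    congr 2
    exact funext fun i ↦ (hb i).symm
  have hT : LinearMap.range T ≤ LinearMap.range (Algebra.linearMap R A) := by
    rintro _ ⟨a, rfl⟩
    have ha : a ∈ Algebra.adjoin R (Set.range x) := hadj ▸ Algebra.mem_top
    rw [Algebra.adjoin_range_eq_range_aeval] at ha
    obtain ⟨f, rfl⟩ := ha
    induction f using MvPolynomial.induction_on' with
    | add f g hf hg =>
      simpa using add_mem hf hg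
    | monomial α r =>
      change T (MvPolynomial.aeval x (MvPolynomial.monomial α r)) ∈ _
      rw [MvPolynomial.aeval_monomial, ← Algebra.smul_def, map_smul]
      refine Submodule.smul_mem _ _ ?_
      rcases h2 α with h0 | ⟨h0, hd⟩
      · rw [h0]; exact zero_mem _
      · rw [h0]
        change _ ∈ (Algebra.ofId R A).range
        refine Subalgebra.prod_mem _ fun i _ ↦ ?_
        obtain ⟨n, hn⟩ := hd i (Finset.mem_univ i)
        dsimp only
        rw [hn, mul_comm, pow_mul]
        exact h _
  let e := LinearEquiv.ofInjective (Algebra.linearMap R A) hinj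
  refine ⟨e.symm ∘ₗ T.codRestrict _ fun a ↦ hT ⟨a, rfl⟩, Q, fun a ↦ ?_⟩
  have : algebraMap R A (e.symm ⟨T a, hT ⟨a, rfl⟩⟩) = T a :=
    congrArg Subtype.val (e.apply_symm_apply ⟨T a, hT ⟨a, rfl⟩⟩)
  conv_lhs => rw [h1 a, ← this]
  rfl

theorem KaehlerDifferential.exists_homotopy_of_isLocalRing {R A : Type*} [CommRing R]
    [CommRing A] [Algebra R A] [Module.Finite R A] [IsLocalRing R] (p : ℕ) [Fact p.Prime]
    [CharP A p] (h : ∀ a : A, a ^ p ∈ (algebraMap R A).range)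
    (hinj : Function.Injective (algebraMap R A)) [Module.Projective A Ω[A⁄R]] :
    ∃ (π : A →ₗ[R] R) (Q : Ω[A⁄R] →ₗ[R] A),
      ∀ a, a = algebraMap R A (π a) + Q (KaehlerDifferential.D R A a) := by
  have : Nontrivial A := hinj.nontrivial
  have : IsLocalRing A := by
    refine IsLocalRing.of_isUnit_or_isUnit_one_sub_self fun a ↦ ?_
    obtain ⟨r, hr⟩ := h a
    have hp := (Fact.out : p.Prime).ne_zero
    refine (IsLocalRing.isUnit_or_isUnit_one_sub_self r).imp (fun hu ↦ ?_) fun hu ↦ ?_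
    · rw [← isUnit_pow_iff hp, ← hr]
      exact hu.map _
    · rw [← isUnit_pow_iff hp, sub_pow_char, one_pow, ← hr, ← map_one (algebraMap R A), ← map_sub]
      exact hu.map _
  have : Module.FinitePresentation A Ω[A⁄R] := Module.finitePresentation_of_projective A _
  obtain ⟨κ, x, b, hb⟩ := Module.exists_basis_of_span_of_flat
    (KaehlerDifferential.D R A) (KaehlerDifferential.span_range_derivation R A)
  have : Finite κ := Module.Finite.finite_basis b
  exact KaehlerDifferential.exists_homotopy_of_basis p h hinj x b hb

/-- A contracting homotopy of `R' → A' → Ω[A'⁄R']` over a localization descends to `R` after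
multiplication by a denominator. -/
theorem KaehlerDifferential.exists_homotopy_of_isLocalization {R A : Type*} [CommRing R]
    [CommRing A] [Algebra R A] [Module.Finite R A] [IsNoetherianRing R] (S : Submonoid R)
    (R' A' : Type*) [CommRing R'] [CommRing A'] [Algebra R R'] [Algebra A A'] [Algebra R A']
    [Algebra R' A'] [IsScalarTower R A A'] [IsScalarTower R R' A'] [IsLocalization S R']
    [IsLocalization (Algebra.algebraMapSubmonoid A S) A']
    (π' : A' →ₗ[R'] R') (Q' : Ω[A'⁄R'] →ₗ[R'] A')
    (h : ∀ a, a = algebraMap R' A' (π' a) + Q' (KaehlerDifferential.D R' A' a)) :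
    ∃ s ∈ S, ∃ (π : A →ₗ[R] R) (Q : Ω[A⁄R] →ₗ[R] A),
      ∀ a, s • a = algebraMap R A (π a) + Q (KaehlerDifferential.D R A a) := by
  have : Module.Finite R Ω[A⁄R] := Module.Finite.trans A _
  have : Module.FinitePresentation R A := Module.finitePresentation_of_finite R A
  have : Module.FinitePresentation R Ω[A⁄R] := Module.finitePresentation_of_finite R _
  let i : A →ₗ[R] A' := (IsScalarTower.toAlgHom R A A').toLinearMap
  let δ : Ω[A⁄R] →ₗ[R] Ω[A'⁄R'] := (KaehlerDifferential.map R R' A A').restrictScalars R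
  obtain ⟨π, s₁, hπ⟩ := Module.FinitePresentation.exists_lift_of_isLocalizedModule S
    (Algebra.linearMap R R') (π'.restrictScalars R ∘ₗ i)
  obtain ⟨Q, s₂, hQ⟩ := Module.FinitePresentation.exists_lift_of_isLocalizedModule S
    i (Q'.restrictScalars R ∘ₗ δ)
  let d : A →ₗ[R] Ω[A⁄R] := (KaehlerDifferential.D R A).toLinearMap
  obtain ⟨s₃, h₃⟩ := Module.Finite.exists_smul_of_comp_eq_of_isLocalizedModule S i
    ((s₁ * s₂) • LinearMap.id)
    (s₂ • Algebra.linearMap R A ∘ₗ π + s₁ • Q ∘ₗ d) (by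
      ext a
      have h1 : algebraMap R R' (π a) = s₁ • π' (i a) := LinearMap.congr_fun hπ a
      have h2 : i (Q (d a)) = s₂ • Q' (KaehlerDifferential.D R' A' (i a)) := by
        refine (LinearMap.congr_fun hQ (d a)).trans ?_
        change s₂ • Q' (KaehlerDifferential.map R R' A A' (KaehlerDifferential.D R A a)) = _
        rw [KaehlerDifferential.map_D]
        rfl
      have h3 : i (algebraMap R A (π a)) = s₁ • algebraMap R' A' (π' (i a)) := by
        have : i (algebraMap R A (π a)) = algebraMap R' A' (algebraMap R R' (π a)) := by
          rw [← IsScalarTower.algebraMap_apply]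
          exact (IsScalarTower.algebraMap_apply R A A' _).symm
        rw [this, h1]
        exact ((Algebra.linearMap R' A').restrictScalars R).map_smul (s₁ : R) _
      change i (((s₁ * s₂ : S) : R) • a) =
        i ((s₂ : R) • algebraMap R A (π a) + (s₁ : R) • Q (d a))
      rw [map_add, map_smul, map_smul, map_smul, h2, h3]
      conv_lhs => rw [h (i a)]
      simp only [Submonoid.smul_def, Submonoid.coe_mul, smul_add, ← mul_smul,
        mul_comm (s₂ : R)])
  refine ⟨s₃ * (s₁ * s₂), mul_mem s₃.2 (mul_mem s₁.2 s₂.2), (s₃ * s₂ : R) • π,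
    (s₃ * s₁ : R) • Q, fun a ↦ ?_⟩
  have := LinearMap.congr_fun h₃ a
  change (s₃ : R) • (((s₁ * s₂ : S) : R) • a) =
    (s₃ : R) • ((s₂ : R) • algebraMap R A (π a) + (s₁ : R) • Q (d a)) at this
  rw [mul_smul]
  refine this.trans ?_
  simp only [smul_add, ← mul_smul, LinearMap.smul_apply]
  congr 1
  simp [Algebra.smul_def]

/-- If `A` is finite over the noetherian ring `R`, `A^p ⊆ R ⊆ A` and `Ω[A⁄R]` is projective, then
the complex `0 → R → A → Ω[A⁄R]` admits an `R`-linear contracting homotopy at `A`. -/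
theorem KaehlerDifferential.exists_homotopy_of_projective {R A : Type u} [CommRing R]
    [CommRing A] [Algebra R A] [Module.Finite R A] [IsNoetherianRing R] (p : ℕ) [Fact p.Prime]
    [CharP A p] (h : ∀ a : A, a ^ p ∈ (algebraMap R A).range)
    (hinj : Function.Injective (algebraMap R A)) [Module.Projective A Ω[A⁄R]] :
    ∃ (π : A →ₗ[R] R) (Q : Ω[A⁄R] →ₗ[R] A),
      ∀ a, a = algebraMap R A (π a) + Q (KaehlerDifferential.D R A a) := by
  let I : Ideal R :=
    { carrier := {s | ∃ (π : A →ₗ[R] R) (Q : Ω[A⁄R] →ₗ[R] A),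
        ∀ a, s • a = algebraMap R A (π a) + Q (KaehlerDifferential.D R A a)}
      zero_mem' := ⟨0, 0, by simp⟩
      add_mem' := by
        rintro s t ⟨π₁, Q₁, h₁⟩ ⟨π₂, Q₂, h₂⟩
        refine ⟨π₁ + π₂, Q₁ + Q₂, fun a ↦ ?_⟩
        rw [add_smul, h₁, h₂]
        simp only [LinearMap.add_apply, map_add]
        abel
      smul_mem' := by
        rintro r s ⟨π, Q, h⟩
        refine ⟨r • π, r • Q, fun a ↦ ?_⟩
        rw [smul_assoc, h]
        simp [Algebra.smul_def, mul_add] }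
  suffices hI : I = ⊤ by
    obtain ⟨π, Q, h1⟩ : (1 : R) ∈ I := hI ▸ Submodule.mem_top
    exact ⟨π, Q, by simpa using h1⟩
  by_contra hI
  obtain ⟨P, hP, hIP⟩ := Ideal.exists_le_maximal I hI
  let R' := Localization P.primeCompl
  let A' := Localization (Algebra.algebraMapSubmonoid A P.primeCompl)
  have : IsLocalRing R' := inferInstanceAs (IsLocalRing (Localization.AtPrime P))
  have hinj' : Function.Injective (algebraMap R' A') :=
    localizationAlgebra_injective (S := A) (M := P.primeCompl) R' A' hinj
  have : Nontrivial A' := hinj'.nontrivial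
  have : CharP A' p := by
    refine (CharP.charP_iff_prime_eq_zero Fact.out).mpr ?_
    rw [← map_natCast (algebraMap A A'), CharP.cast_eq_zero, map_zero]
  have : Module.Finite R' A' := Module.Finite.of_isLocalization R A P.primeCompl
  have : Algebra.IsPushout R R' A A' :=
    (Algebra.isPushout_of_isLocalization P.primeCompl R' A A').symm
  have : Module.Projective A' Ω[A'⁄R'] :=
    .of_equiv (KaehlerDifferential.tensorKaehlerEquiv R R' A A')
  have hpow : ∀ a : A', a ^ p ∈ (algebraMap R' A').range := by
    intro a
    obtain ⟨⟨x, ⟨_, s, hs, rfl⟩⟩, rfl⟩ := IsLocalization.mk'_surjective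
      (Algebra.algebraMapSubmonoid A P.primeCompl) a
    obtain ⟨r, hr⟩ := h x
    refine ⟨IsLocalization.mk' R' r (⟨s, hs⟩ ^ p : P.primeCompl), ?_⟩
    rw [IsLocalization.algebraMap_mk' A R' A', ← IsLocalization.mk'_pow, hr]
    congr 1
    ext
    simp
  obtain ⟨π', Q', h'⟩ := KaehlerDifferential.exists_homotopy_of_isLocalRing
    (R := R') (A := A') p hpow hinj'
  obtain ⟨s, hs, h⟩ := KaehlerDifferential.exists_homotopy_of_isLocalization (A := A)
    P.primeCompl R' A' π' Q' h'
  exact hs (hIP h)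

/-- Differentials relative to a subring of `p`-th powers agree with absolute ones in characteristic
`p`. -/
theorem KaehlerDifferential.map_bijective_of_algebraMap_eq_pow {k R A : Type*} [CommRing k]
    [CommRing R] [CommRing A] [Algebra k R] [Algebra k A] [Algebra R A] [IsScalarTower k R A]
    (p : ℕ) [CharP A p] (h : ∀ r : R, ∃ a : A, a ^ p = algebraMap R A r) :
    Function.Bijective (KaehlerDifferential.map k R A A) := by
  refine ⟨?_, KaehlerDifferential.map_surjective k R A⟩
  rw [injective_iff_map_eq_zero]
  intro ω hω
  obtain ⟨z, rfl⟩ := (KaehlerDifferential.exact_mapBaseChange_map k R A ω).mp hω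
  suffices KaehlerDifferential.mapBaseChange k R A = 0 by simp [this]
  have h0 : KaehlerDifferential.map k k R A = 0 := by
    refine LinearMap.ext_on (KaehlerDifferential.span_range_derivation k R) ?_
    rintro _ ⟨r, rfl⟩
    obtain ⟨a, ha⟩ := h r
    rw [KaehlerDifferential.map_D, ← ha, Derivation.leibniz_pow, ← Nat.cast_smul_eq_nsmul A,
      CharP.cast_eq_zero, zero_smul, LinearMap.zero_apply]
  ext z
  simp [KaehlerDifferential.mapBaseChange_tmul, h0]

/-- For `A` smooth over a perfect field, the identity of `A` is the sum of an `A^p`-linear map to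
`A^p` and a combination of derivations with `A^p`-linear coefficients. -/
theorem Derivation.exists_frobenius_homotopy (k : Type u) {A : Type u} [Field k] [PerfectField k]
    (p : ℕ) [Fact p.Prime] [CharP k p] [CommRing A] [Algebra k A] [Algebra.Smooth k A]
    [CharP A p] :
    ∃ (π : A →ₗ[(frobenius A p).range] (frobenius A p).range) (n : ℕ)
      (D : Fin n → Derivation k A A) (Q : Fin n → A →ₗ[(frobenius A p).range] A),
      ∀ a, a = (π a : A) + ∑ i, Q i (D i a) := by
  let R := (frobenius A p).range
  have hk : ∀ c : k, algebraMap k A c ∈ R := by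
    intro c
    obtain ⟨b, rfl⟩ := surjective_frobenius k p c
    exact ⟨algebraMap k A b, by simp [frobenius_def]⟩
  let : Algebra k R := ((algebraMap k A).codRestrict R hk).toAlgebra
  have : IsScalarTower k R A := .of_algebraMap_eq fun _ ↦ rfl
  have hpow : ∀ a : A, a ^ p ∈ (algebraMap R A).range := fun a ↦ ⟨⟨a ^ p, a, rfl⟩, rfl⟩
  have : Algebra.FiniteType R A := .of_restrictScalars_finiteType k R A
  have : Algebra.IsIntegral R A := ⟨fun a ↦ by
    obtain ⟨r, hr⟩ := hpow a
    exact .of_pow (Fact.out : p.Prime).pos (hr ▸ isIntegral_algebraMap)⟩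
  have : Module.Finite R A := Algebra.IsIntegral.finite
  have : IsNoetherianRing A := Algebra.FiniteType.isNoetherianRing k A
  have : IsNoetherianRing R :=
    isNoetherianRing_of_surjective A R _ (frobenius A p).rangeRestrict_surjective
  have : Module.Projective A Ω[A⁄R] :=
    .of_equiv (LinearEquiv.ofBijective _
      (KaehlerDifferential.map_bijective_of_algebraMap_eq_pow (k := k) (R := R) (A := A) p
        fun ⟨_, a, ha⟩ ↦ ⟨a, ha⟩))
  obtain ⟨π, Q, h⟩ := KaehlerDifferential.exists_homotopy_of_projective (R := R) (A := A)
    p hpow Subtype.val_injective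
  obtain ⟨n, f, g, -, -, hfg⟩ := Module.Finite.exists_comp_eq_id_of_projective A Ω[A⁄R]
  refine ⟨π, n, fun i ↦
    ((LinearMap.proj i ∘ₗ g).compDer (KaehlerDifferential.D R A)).restrictScalars k,
    fun i ↦ Q ∘ₗ (LinearMap.toSpanSingleton A _ (f (Pi.single i 1))).restrictScalars R,
    fun a ↦ (h a).trans ?_⟩
  congr 1
  rw [← LinearMap.id_apply (R := A) (KaehlerDifferential.D R A a), ← hfg, LinearMap.comp_apply,
    LinearMap.pi_apply_eq_sum_univ f, map_sum]
  refine Finset.sum_congr rfl fun i _ ↦ ?_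
  have hi : (fun j ↦ if i = j then (1 : A) else 0) = Pi.single i 1 := by
    ext j
    simp [Pi.single_apply, eq_comm]
  rw [hi]
  rfl

/-- **Affine Cartier–Frobenius descent, pullback direction.**
Let `k` be a perfect field of characteristic `p`, `A` a smooth `k`-algebra (of characteristic
`p`) and `N` a module over the subring `A^p` of `p`-th powers. Then `n ↦ 1 ⊗ n` is an
injection of `N` into `A ⊗_{A^p} N` whose image is precisely the set of elements annihilated
by `D ⊗ id` for every `k`-derivation `D` of `A`. -/
theorem frobenius_pullback_horizontal_sections
    {k A : Type u} [Field k] [PerfectField k] (p : ℕ) [Fact p.Prime] [CharP k p]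
    [CommRing A] [Algebra k A] [Algebra.Smooth k A] [CharP A p]
    (N : Type v) [AddCommGroup N] [Module (frobenius A p).range N] :
    Function.Injective (fun n : N => (1 : A) ⊗ₜ[(frobenius A p).range] n) ∧
    Set.range (fun n : N => (1 : A) ⊗ₜ[(frobenius A p).range] n) =
      {x : A ⊗[(frobenius A p).range] N |
        ∀ D : Derivation k A A, LinearMap.rTensor N (D.apLinear p) x = 0} := by
  obtain ⟨π, n, D, Q, h⟩ := Derivation.exists_frobenius_homotopy k (A := A) p
  have hπ : π 1 = 1 := Subtype.ext (by simpa using (h 1).symm)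
  constructor
  · refine Function.LeftInverse.injective
      (g := TensorProduct.lid (frobenius A p).range N ∘ π.rTensor N) fun m ↦ ?_
    simp [hπ]
  · ext x
    constructor
    · rintro ⟨m, rfl⟩ E
      have : E.apLinear p 1 = 0 := E.map_one_eq_zero
      simp [this]
    · intro hx
      have hsum : ∀ x : A ⊗[(frobenius A p).range] N,
          x = 1 ⊗ₜ TensorProduct.lid (frobenius A p).range N (π.rTensor N x) +
            ∑ i, (Q i).rTensor N (((D i).apLinear p).rTensor N x) := by
        intro x
        induction x using TensorProduct.induction_on with
        | zero => simp
        | tmul a m =>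
          have ha : a = π a • (1 : A) + ∑ i, Q i ((D i).apLinear p a) := by
            rw [Subring.smul_def, smul_eq_mul, mul_one]
            exact h a
          simp only [LinearMap.rTensor_tmul, TensorProduct.lid_tmul, ← TensorProduct.sum_tmul,
            ← TensorProduct.smul_tmul, ← TensorProduct.add_tmul]
          rw [← ha]
        | add x y hx hy =>
          conv_lhs => rw [hx, hy]
          simp only [map_add, TensorProduct.tmul_add, Finset.sum_add_distrib]
          abel
      refine ⟨TensorProduct.lid _ N (π.rTensor N x), ((hsum x).trans ?_).symm⟩
      simp [hx _]
end

section
/- Affine form of Corollary 3.4 for GL_n: let n ≥ 1 and let Ω be an n×n matrix with entries in Ω¹_{A/k}; for a k-derivation D of A write Ω(D) for the n×n matrix over A with entries ⟨Ω_{ij},D⟩, and let ∇_D be the additive endomorphism of Aⁿ given by ∇_D(v) = D(v) + Ω(D)·v, where D(v) means entrywise application of D. Then the following are equivalent. (1) ∇ is flat (∇_{[D,D']} = ∇_D∘∇_{D'} − ∇_{D'}∘∇_D for all k-derivations D, D' of A) and has vanishing p-curvature ((∇_D)^p = ∇_{D'} whenever D' is a k-derivation whose underlying linear map equals the p-th iterate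 of that of D). (2) Ω is Zariski-locally a Maurer–Cartan form: for every prime ideal 𝔭 of A there exist g ∈ A ∖ 𝔭 and an invertible n×n matrix G over the localization A_g such that the matrix of canonical images of the entries of Ω in Ω¹_{A_g/k} equals G⁻¹·dG, i.e., its (i,j) entry is Σ_l (G⁻¹)_{il}·d(G_{lj}). -/
/-!
The `GL_n` case: a matrix `Ω` of `1`-forms defines a flat connection with vanishing
`p`-curvature on `Aⁿ` if and only if `Ω` is Zariski-locally a Maurer–Cartan form `G⁻¹ dG`.
-/

universe u

/-- The additive endomorphism `v ↦ D(v) + W · v` of `Aⁿ`: entrywise application of the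
derivation `D` plus multiplication by the matrix `W`. -/
noncomputable def matConn {k A : Type*} [CommRing k] [CommRing A] [Algebra k A] {n : ℕ}
    (D : Derivation k A A) (W : Matrix (Fin n) (Fin n) A) : AddMonoid.End (Fin n → A) :=
  AddMonoidHom.mk' (fun v => (fun i => D (v i)) + W.mulVec v) (by
    intro v w
    simp only [Matrix.mulVec_add]
    funext i
    simp only [Pi.add_apply, map_add]
    ring)

/-- Evaluation of a matrix of `1`-forms at a derivation, entrywise. -/
noncomputable def matOfForms {k A : Type*} [CommRing k] [CommRing A] [Algebra k A] {n : ℕ}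
    (Ω : Matrix (Fin n) (Fin n) (Ω[A⁄k])) (D : Derivation k A A) :
    Matrix (Fin n) (Fin n) A :=
  fun i j => D.liftKaehlerDifferential (Ω i j)

open TensorProduct in
/-- In characteristic `p`, the `p`-th iterate of a derivation is a derivation. -/
theorem Derivation.iterate_prime_leibniz {k A : Type*} [Field k] (p : ℕ) [Fact p.Prime] [CharP k p]
    [CommRing A] [Algebra k A] (D : Derivation k A A) (a b : A) :
    ((D : A →ₗ[k] A) ^ p) (a * b)
      = a • ((D : A →ₗ[k] A) ^ p) b + b • ((D : A →ₗ[k] A) ^ p) a := by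
  set L : Module.End k A := (D : A →ₗ[k] A) with hL
  let X : Module.End k (A ⊗[k] A) := L.rTensor A
  let Y : Module.End k (A ⊗[k] A) := L.lTensor A
  have hXY : Commute X Y := by
    apply TensorProduct.ext'
    intro x y
    simp [X, Y]
  have hmul : ∀ (m : ℕ) (t : A ⊗[k] A),
      LinearMap.mul' k A (((X + Y) ^ m) t) = (L ^ m) (LinearMap.mul' k A t) := by
    have h1 : ∀ t : A ⊗[k] A, LinearMap.mul' k A ((X + Y) t) = L (LinearMap.mul' k A t) := by
      intro t
      induction t with
      | zero => simp
      | add x y hx hy => simp only [map_add, hx, hy]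
      | tmul x y => simp [X, Y, hL]; ring
    intro m
    induction m with
    | zero => simp
    | succ m ih =>
      intro t
      rw [pow_succ', pow_succ', Module.End.mul_apply, Module.End.mul_apply, h1, ih]
  have hp : (X + Y) ^ p = X ^ p + Y ^ p := by
    obtain ⟨r, hr⟩ := hXY.exists_add_pow_prime_eq (Fact.out : p.Prime)
    rw [hr]
    have h0 : ((p : ℕ) : Module.End k (A ⊗[k] A)) = 0 := by
      rw [← _root_.map_natCast (algebraMap k (Module.End k (A ⊗[k] A))),
        CharP.cast_eq_zero, map_zero]
    simp [h0]
  have := hmul p (a ⊗ₜ b)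
  rw [hp] at this
  simp only [X, Y, LinearMap.rTensor_pow, LinearMap.lTensor_pow, LinearMap.add_apply,
    LinearMap.rTensor_tmul, LinearMap.lTensor_tmul, map_add, LinearMap.mul'_apply] at this
  rw [← this, smul_eq_mul, smul_eq_mul]
  ring

/-- The `p`-th iterate of a derivation in characteristic `p`, as a derivation. -/
def Derivation.iteratePrime {k A : Type*} [Field k] (p : ℕ) [Fact p.Prime] [CharP k p]
    [CommRing A] [Algebra k A] (D : Derivation k A A) : Derivation k A A :=
  Derivation.mk' ((D : A →ₗ[k] A) ^ p) (D.iterate_prime_leibniz p)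

/-- Near a prime, a finitely presented flat module is free on members of any generating family;
the basis and its dual are given here up to a factor `g` outside the prime. -/
theorem Module.exists_dual_family_of_span_eq_top {A M : Type u} [CommRing A] [AddCommGroup M]
    [Module A M] [Module.FinitePresentation A M] [Module.Flat A M] {ι : Type u} (v : ι → M)
    (hv : Submodule.span A (Set.range v) = ⊤) (P : Ideal A) [P.IsPrime] :
    ∃ (κ : Type u) (_ : Fintype κ) (_ : DecidableEq κ) (a : κ → ι) (φ : κ → M →ₗ[A] A) (g : A),
      g ∉ P ∧ (∀ i j, φ i (v (a j)) = if i = j then g else 0) ∧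
      ∀ m, g • m = ∑ i, φ i m • v (a i) := by
  classical
  let S := P.primeCompl
  let R := Localization.AtPrime P
  let f := LocalizedModule.mkLinearMap S M
  have hsp : Submodule.span R (Set.range (f ∘ v)) = ⊤ := by
    rw [Set.range_comp]
    exact span_eq_top_of_isLocalizedModule R S f hv
  obtain ⟨κ, a, b, hb⟩ := Module.exists_basis_of_span_of_flat (f ∘ v) hsp
  have : Finite κ := Module.Finite.finite_basis b
  let : Fintype κ := Fintype.ofFinite κ
  have hlift : ∀ i, ∃ (h : M →ₗ[A] A) (s : S),
      (Algebra.linearMap A R) ∘ₗ h = s • (((b.coord i).restrictScalars A) ∘ₗ f) := fun i =>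
    Module.FinitePresentation.exists_lift_of_isLocalizedModule S (Algebra.linearMap A R) _
  choose h s hs using hlift
  let t : S := ∏ i, s i
  let h' : κ → M →ₗ[A] A := fun i => ((∏ j ∈ Finset.univ.erase i, s j : S) : A) • h i
  have hh' : ∀ i m, algebraMap A R (h' i m) = algebraMap A R t * b.coord i (f m) := by
    intro i m
    have h1 : algebraMap A R (h i m) = algebraMap A R (s i) * b.coord i (f m) := by
      have := LinearMap.congr_fun (hs i) m
      simpa [Submonoid.smul_def, Algebra.smul_def] using this
    have h2 : t = (∏ j ∈ Finset.univ.erase i, s j) * s i :=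
      (Finset.prod_erase_mul _ _ (Finset.mem_univ i)).symm
    rw [h2]
    simp only [h', LinearMap.smul_apply, smul_eq_mul, map_mul, h1, Submonoid.coe_mul]
    ring
  have hδ : ∀ i j, ∃ c : S, (c : A) * h' i (v (a j)) = c * (if i = j then (t : A) else 0) := by
    intro i j
    apply IsLocalization.exists_of_eq (M := S) (S := R)
    rw [hh']
    have : f (v (a j)) = b j := (hb j).symm
    rw [this, Module.Basis.coord_apply, Module.Basis.repr_self, Finsupp.single_apply]
    by_cases hij : i = j
    · simp [hij]
    · simp [hij, Ne.symm hij]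
  choose c hc using hδ
  obtain ⟨e, he⟩ : ∃ e : S, e • ((t : A) • LinearMap.id : M →ₗ[A] M)
      = e • ∑ i, (h' i).smulRight (v (a i)) := by
    apply Module.Finite.exists_smul_of_comp_eq_of_isLocalizedModule S f
    ext m
    simp only [LinearMap.comp_apply, LinearMap.smul_apply, LinearMap.id_apply, map_smul,
      LinearMap.sum_apply, LinearMap.smulRight_apply, map_sum]
    have h3 : ∀ (x : A) (y : LocalizedModule S M), x • y = algebraMap A R x • y :=
      fun x y => (algebraMap_smul R x y).symm
    have h4 : f m = ∑ i, b.coord i (f m) • f (v (a i)) := by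
      conv_lhs => rw [← b.sum_repr (f m)]
      exact Finset.sum_congr rfl fun i _ => by rw [hb i]; rfl
    conv_lhs => rw [h4, h3, Finset.smul_sum]
    refine Finset.sum_congr rfl fun i _ => ?_
    rw [h3, hh', mul_smul]
  let C : S := ∏ i, ∏ j, c i j
  have hC : ∀ i j, (C : A) * h' i (v (a j)) = C * (if i = j then (t : A) else 0) := by
    intro i j
    have : c i j ∣ C := (Finset.dvd_prod_of_mem _ (Finset.mem_univ j)).trans
      (Finset.dvd_prod_of_mem (fun i => ∏ j, c i j) (Finset.mem_univ i))
    obtain ⟨q, hq⟩ := this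
    rw [hq, Submonoid.coe_mul, mul_comm (c i j : A), mul_assoc, mul_assoc, hc]
  refine ⟨κ, inferInstance, inferInstance, a, fun i => ((C * e : S) : A) • h' i,
    ((C * e * t : S) : A), (C * e * t).2, ?_, ?_⟩
  · intro i j
    simp only [LinearMap.smul_apply, smul_eq_mul, Submonoid.coe_mul]
    rw [mul_comm (C : A), mul_assoc, hC]
    split_ifs <;> ring
  · intro m
    have := LinearMap.congr_fun he m
    simp only [LinearMap.smul_apply, LinearMap.id_apply, LinearMap.sum_apply,
      LinearMap.smulRight_apply, Submonoid.smul_def] at this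
    simp only [LinearMap.smul_apply, Submonoid.coe_mul, mul_smul, this, Finset.smul_sum,
      smul_assoc]

/-- In characteristic `p`, derivations kill `p`-th powers. -/
theorem Derivation.map_pow_prime {k A M : Type*} [Field k] (p : ℕ) [CharP k p]
    [CommRing A] [Algebra k A] [AddCommGroup M] [Module A M] [Module k M]
    (D : Derivation k A M) (a : A) : D (a ^ p) = 0 := by
  rw [D.leibniz_pow, ← Nat.cast_smul_eq_nsmul k, CharP.cast_eq_zero, zero_smul]

/-- A derivation killing coordinates is torsion. -/
theorem Derivation.mul_apply_eq_zero_of_span {k A κ : Type*} [Field k] [CommRing A] [Algebra k A]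
    [Fintype κ] {x : κ → A} {φ : κ → A → A} {g : A}
    (h : ∀ a, g • KaehlerDifferential.D k A a = ∑ i, φ i a • KaehlerDifferential.D k A (x i))
    (D : Derivation k A A) (hD : ∀ i, D (x i) = 0) (a : A) : g * D a = 0 := by
  have := congrArg D.liftKaehlerDifferential (h a)
  simpa [hD] using this

/-- A smooth algebra has, near a prime, coordinates `x i` and commuting derivations `E i` of
vanishing `p`-th power dual to the `d (x i)`, up to a factor `g` outside the prime. -/
theorem Algebra.Smooth.exists_commuting_derivations {k A : Type u} [Field k] (p : ℕ)
    [Fact p.Prime] [CharP k p] [CommRing A] [Algebra k A] [Algebra.Smooth k A]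
    (P : Ideal A) [hP : P.IsPrime] :
    ∃ (κ : Type u) (_ : Fintype κ) (_ : DecidableEq κ) (x : κ → A)
      (E : κ → Derivation k A A) (g : A), g ∉ P ∧
      (∀ i j, E i (x j) = if i = j then g else 0) ∧ (∀ i, E i g = 0) ∧
      (∀ i j, ⁅E i, E j⁆ = 0) ∧ (∀ i, (E i : A →ₗ[k] A) ^ p = 0) ∧
      ∀ ω : Ω[A⁄k], g • ω =
        ∑ i, (E i).liftKaehlerDifferential ω • KaehlerDifferential.D k A (x i) := by
  have hp : p.Prime := Fact.out
  obtain ⟨κ, _, _, x, φ, g₀, hg₀, hφ, hspan⟩ := Module.exists_dual_family_of_span_eq_top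
    (KaehlerDifferential.D k A) (KaehlerDifferential.span_range_derivation k A) P
  let D : κ → Derivation k A A := fun i =>
    (g₀ ^ (p - 1) • φ i).compDer (KaehlerDifferential.D k A)
  have hDa : ∀ i a, D i a = g₀ ^ (p - 1) * φ i (KaehlerDifferential.D k A a) := fun i a => rfl
  have hlift : ∀ i ω, (D i).liftKaehlerDifferential ω = g₀ ^ (p - 1) * φ i ω := by
    intro i ω
    have : (D i).liftKaehlerDifferential = g₀ ^ (p - 1) • φ i :=
      Derivation.liftKaehlerDifferential_unique _ _ (by ext a; simp [hDa])
    rw [this]; rfl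
  have hpow : g₀ ^ (p - 1) * g₀ = g₀ ^ p := by
    rw [← pow_succ, Nat.sub_add_cancel hp.one_le]
  have hDx : ∀ i j, D i (x j) = if i = j then g₀ ^ p else 0 := by
    intro i j
    rw [hDa, hφ]
    split_ifs
    · exact hpow
    · simp
  have hDspan : ∀ ω : Ω[A⁄k], g₀ ^ p • ω =
      ∑ i, (D i).liftKaehlerDifferential ω • KaehlerDifferential.D k A (x i) := by
    intro ω
    simp_rw [hlift, mul_smul, ← Finset.smul_sum, ← hspan, ← mul_smul, hpow]
  have hkill : ∀ X : Derivation k A A, (∀ i, X (x i) = 0) → ∀ a, g₀ ^ p * X a = 0 := by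
    intro X hX a
    exact X.mul_apply_eq_zero_of_span (φ := fun i a => D i a)
      (fun a => by simpa using hDspan (KaehlerDifferential.D k A a)) hX a
  have hconst : ∀ i, D i (g₀ ^ p) = 0 := fun i => (D i).map_pow_prime p g₀
  have hite : ∀ i j, D i (D j (x i)) = 0 := by
    intro i j
    rw [hDx]
    split_ifs <;> simp [hconst]
  have hEa : ∀ i a, (g₀ ^ p • D i) a = g₀ ^ p * D i a := fun i a => rfl
  refine ⟨κ, inferInstance, inferInstance, x, fun i => g₀ ^ p • D i, g₀ ^ p * g₀ ^ p, ?_, ?_, ?_,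
    ?_, ?_, ?_⟩
  · rw [← mul_pow]
    exact fun h => hg₀ (or_self_iff.mp (hP.mem_or_mem (hP.mem_of_pow_mem _ h)))
  · intro i j
    rw [hEa, hDx]
    split_ifs <;> simp
  · intro i
    rw [hEa, Derivation.leibniz, hconst]
    simp
  · intro i j
    have h0 := hkill ⁅D i, D j⁆ (fun l => by
      rw [Derivation.commutator_apply, hDx, hDx]
      split_ifs <;> simp [hconst])
    ext a
    rw [Derivation.commutator_apply, hEa, hEa, hEa, hEa, Derivation.leibniz, Derivation.leibniz,
      hconst, hconst]
    have := h0 a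
    rw [Derivation.commutator_apply] at this
    simp only [smul_eq_mul, mul_zero, add_zero, Derivation.zero_apply]
    linear_combination g₀ ^ p * this
  · intro i
    have h0 := hkill ((D i).iteratePrime p) (fun l => by
      change ((D i : A →ₗ[k] A) ^ p) (x l) = 0
      obtain ⟨q, hq⟩ := Nat.exists_eq_add_of_le hp.two_le
      rw [hq, add_comm, pow_add, Module.End.mul_apply]
      have : ((D i : A →ₗ[k] A) ^ 2) (x l) = 0 := by
        rw [pow_two, Module.End.mul_apply]
        simp only [Derivation.coeFn_coe, hDx]
        split_ifs <;> simp [hconst]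
      rw [this, map_zero])
    have h1 : ∀ m : ℕ, ∀ a, (((g₀ ^ p • D i : Derivation k A A) : A →ₗ[k] A) ^ m) a
        = (g₀ ^ p) ^ m * ((D i : A →ₗ[k] A) ^ m) a := by
      intro m
      induction m with
      | zero => simp
      | succ m ih =>
        intro a
        have hc : D i ((g₀ ^ p) ^ m) = 0 := by rw [Derivation.leibniz_pow, hconst]; simp
        rw [pow_succ', Module.End.mul_apply, ih, pow_succ' (D i : A →ₗ[k] A), Module.End.mul_apply]
        simp only [Derivation.coeFn_coe, hEa, Derivation.leibniz, hc, smul_eq_mul]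
        ring
    ext a
    rw [h1]
    have h2 := h0 a
    change g₀ ^ p * ((D i : A →ₗ[k] A) ^ p) a = 0 at h2
    obtain ⟨q, hq⟩ := Nat.exists_eq_add_of_le hp.one_le
    have h3 : (g₀ ^ p) ^ p = (g₀ ^ p) ^ q * g₀ ^ p := by
      conv_lhs => rw [show (g₀ ^ p) ^ p = (g₀ ^ p) ^ (1 + q) by rw [← hq]]
      ring
    rw [h3, mul_assoc, h2, mul_zero, LinearMap.zero_apply]
  · intro ω
    have h1 : ∀ i, (g₀ ^ p • D i).liftKaehlerDifferential ω
        = g₀ ^ p * (D i).liftKaehlerDifferential ω := by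
      intro i
      have : (g₀ ^ p • D i).liftKaehlerDifferential = g₀ ^ p • (D i).liftKaehlerDifferential :=
        Derivation.liftKaehlerDifferential_unique _ _ (by ext a; simp)
      rw [this]; rfl
    simp_rw [h1, mul_smul, ← Finset.smul_sum, hDspan]

section Horizontal

variable {k A M κ : Type*} [Field k] [CommRing A] [Algebra k A] [AddCommGroup M] [Module A M]

/-- The elements `v` some multiple `g ^ N • v` of which lies in `S`. -/
def Submodule.powSaturation (S : Submodule A M) (g : A) : Submodule A M where
  carrier := {v | ∃ N : ℕ, g ^ N • v ∈ S}
  zero_mem' := ⟨0, by simp⟩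
  add_mem' := by
    rintro v w ⟨N, hN⟩ ⟨N', hN'⟩
    refine ⟨N + N', ?_⟩
    rw [smul_add, pow_add, mul_smul, mul_smul, smul_comm]
    exact S.add_mem (S.smul_mem _ hN) (S.smul_mem _ hN')
  smul_mem' := by
    rintro a v ⟨N, hN⟩
    exact ⟨N, by rw [smul_comm]; exact S.smul_mem _ hN⟩

theorem Submodule.mem_powSaturation {S : Submodule A M} {g : A} {v : M} :
    v ∈ S.powSaturation g ↔ ∃ N : ℕ, g ^ N • v ∈ S := Iff.rfl

theorem Submodule.le_powSaturation (S : Submodule A M) (g : A) : S ≤ S.powSaturation g :=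
  fun v hv => ⟨0, by simpa using hv⟩

theorem Submodule.mem_powSaturation_of_pow_smul_mem {S : Submodule A M} {g : A} {v : M} {N : ℕ}
    (h : g ^ N • v ∈ S.powSaturation g) : v ∈ S.powSaturation g := by
  obtain ⟨N', hN'⟩ := h
  exact ⟨N' + N, by rwa [pow_add, mul_smul]⟩

theorem AddMonoid.End.pow_apply_pow_smul {D : Derivation k A A} {T : AddMonoid.End M}
    (hT : ∀ (a : A) v, T (a • v) = D a • v + a • T v) {x g : A} (hx : D x = g) (hg : D g = 0)
    (m : ℕ) (w : M) (hw : T w = 0) : (T ^ m) (x ^ m • w) = (m.factorial : A) • g ^ m • w := by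
  induction m generalizing w with
  | zero => simp
  | succ m ih =>
    have h1 : T (x ^ (m + 1) • w) = x ^ m • (((m + 1 : ℕ) : A) • g • w) := by
      rw [hT, hw, D.leibniz_pow, hx]
      simp only [smul_zero, add_zero, Nat.add_sub_cancel, nsmul_eq_mul, smul_eq_mul, ← mul_smul]
      ring_nf
    rw [pow_succ, AddMonoid.End.coe_mul, Function.comp_apply, h1, ih _ (by simp [hT, hg, hw])]
    simp only [← mul_smul, Nat.factorial_succ]
    push_cast
    ring_nf

/-- **Cartier descent.** Commuting `p`-nilpotent operators satisfying the Leibniz rule over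
derivations dual to coordinates have enough common zeros, up to powers of `g`. -/
theorem Derivation.exists_pow_smul_mem_span_horizontal (p : ℕ) [Fact p.Prime] [CharP k p]
    [Finite κ] [DecidableEq κ] {x : κ → A} {D : κ → Derivation k A A} {g : A}
    (hx : ∀ i j, D i (x j) = if i = j then g else 0) (hg : ∀ i, D i g = 0)
    {T : κ → AddMonoid.End M} (hT : ∀ i (a : A) v, T i (a • v) = D i a • v + a • T i v)
    (hcomm : ∀ i j v, T i (T j v) = T j (T i v)) (hnil : ∀ i v, (T i ^ p) v = 0) (v : M) :
    ∃ N : ℕ, g ^ N • v ∈ Submodule.span A {w | ∀ i, T i w = 0} := by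
  have hgpow : ∀ i (N : ℕ), D i (g ^ N) = 0 := fun i N => by rw [leibniz_pow, hg]; simp
  let K : Finset κ → Submodule A M := fun s =>
    (Submodule.span A {w | ∀ i ∈ s, T i w = 0}).powSaturation g
  have hstep : ∀ (s : Finset κ) (j : κ), ∀ m ≤ p, ∀ v : M, (∀ i ∈ s, T i v = 0) →
      (T j ^ m) v = 0 → v ∈ K (insert j s) := by
    intro s j m
    induction m with
    | zero =>
      intro _ v _ hv
      have : v = 0 := by simpa using hv
      simp [this]
    | succ m ih =>
      intro hm v hvs hv
      have hpowcomm : ∀ i (n : ℕ) u, T i ((T j ^ n) u) = (T j ^ n) (T i u) := by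
        intro i n
        induction n with
        | zero => simp
        | succ n ihn =>
          intro u
          simp only [pow_succ, AddMonoid.End.coe_mul, Function.comp_apply, ihn, hcomm i j]
      set w := (T j ^ m) v with hw
      have hwj : T j w = 0 := by rw [pow_succ'] at hv; exact hv
      have hws : ∀ i ∈ s, T i w = 0 := fun i hi => by rw [hw, hpowcomm, hvs i hi, map_zero]
      have hwK : w ∈ K (insert j s) := by
        refine Submodule.le_powSaturation _ _ (Submodule.subset_span fun i hi => ?_)
        rcases Finset.mem_insert.mp hi with rfl | hi
        · exact hwj
        · exact hws i hi
      have hconst : ∀ i u, T i ((m.factorial : A) • g ^ m • u)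
          = (m.factorial : A) • g ^ m • T i u := by
        intro i u
        rw [hT, hT, hgpow]
        simp
      by_cases hjs : j ∈ s
      · exact Submodule.le_powSaturation _ _ (Submodule.subset_span fun i hi => by
          rw [Finset.insert_eq_of_mem hjs] at hi
          exact hvs i hi)
      have hu : (m.factorial : A) • g ^ m • v - x j ^ m • w ∈ K (insert j s) := by
        apply ih (by omega)
        · intro i hi
          have hij : i ≠ j := fun h => hjs (h ▸ hi)
          rw [map_sub, hconst, hvs i hi, hT, hws i hi, leibniz_pow, hx, if_neg hij]
          simp
        · have hTm : ∀ (n : ℕ) u, (T j ^ n) ((m.factorial : A) • g ^ m • u)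
              = (m.factorial : A) • g ^ m • (T j ^ n) u := by
            intro n
            induction n with
            | zero => simp
            | succ n ihn =>
              intro u
              simp only [pow_succ, AddMonoid.End.coe_mul, Function.comp_apply, ihn, hconst]
          rw [map_sub, hTm, AddMonoid.End.pow_apply_pow_smul (hT j) (by simp [hx]) (hg j) m w hwj,
            sub_self]
      have hfac : (m.factorial : k) ≠ 0 := by
        rw [Ne, CharP.cast_eq_zero_iff k p, (Fact.out : p.Prime).dvd_factorial]
        omega
      have hmem : (m.factorial : A) • g ^ m • v ∈ K (insert j s) := by
        have := (K (insert j s)).add_mem hu ((K (insert j s)).smul_mem (x j ^ m) hwK)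
        rwa [sub_add_cancel] at this
      refine Submodule.mem_powSaturation_of_pow_smul_mem (N := m) ?_
      have := (K (insert j s)).smul_mem (algebraMap k A (m.factorial : k)⁻¹) hmem
      rwa [← mul_smul, ← _root_.map_natCast (algebraMap k A), ← _root_.map_mul,
        inv_mul_cancel₀ hfac, _root_.map_one,
        one_smul] at this
  have hall : ∀ s : Finset κ, K s = ⊤ := by
    intro s
    induction s using Finset.induction_on with
    | empty =>
      rw [eq_top_iff]
      intro v _
      exact Submodule.le_powSaturation _ _ (Submodule.subset_span (by simp))
    | insert j s _ ih =>
      rw [eq_top_iff, ← ih]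
      rintro v ⟨N, hN⟩
      refine Submodule.mem_powSaturation_of_pow_smul_mem (N := N) ?_
      refine (Submodule.span_le.mpr fun w hw => ?_ :
        Submodule.span A {w | ∀ i ∈ s, T i w = 0} ≤ K (insert j s)) hN
      exact hstep s j p le_rfl w hw (hnil j w)
  let _ := Fintype.ofFinite κ
  have := hall Finset.univ ▸ Submodule.mem_top (x := v)
  simpa [K, Submodule.mem_powSaturation] using this

end Horizontal

/-- If `H` spans `Aⁿ` near the prime `P`, then some `n` members of `H` are the columns of a matrix
whose determinant lies outside `P`. -/
theorem Matrix.exists_det_notMem_of_span {A : Type*} [CommRing A] {n : ℕ} (P : Ideal A) [P.IsPrime]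
    {H : Set (Fin n → A)} (hH : ∀ v, ∃ g ∉ P, g • v ∈ Submodule.span A H) :
    ∃ F : Matrix (Fin n) (Fin n) A, (∀ j, (fun i => F i j) ∈ H) ∧ F.det ∉ P := by
  let K := P.ResidueField
  let ψ : (Fin n → A) →ₗ[A] (Fin n → K) := (Algebra.linearMap A K).compLeft (Fin n)
  let v : H → Fin n → K := fun h => ψ h
  have hmem : ∀ w, ψ w ∈ Submodule.span K (Set.range v) := by
    intro w
    obtain ⟨g, hg, hgw⟩ := hH w
    have hle : Submodule.span A H ≤ ((Submodule.span K (Set.range v)).restrictScalars A).comap ψ :=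
      Submodule.span_le.mpr fun h hh => Submodule.subset_span ⟨⟨h, hh⟩, rfl⟩
    have h1 : ψ (g • w) ∈ Submodule.span K (Set.range v) := hle hgw
    rw [map_smul, ← algebraMap_smul K] at h1
    have hg0 : algebraMap A K g ≠ 0 := by rwa [Ne, Ideal.algebraMap_residueField_eq_zero]
    rwa [Submodule.smul_mem_iff _ hg0] at h1
  have htop : Submodule.span K (Set.range v) = ⊤ := by
    rw [eq_top_iff, ← (Pi.basisFun K (Fin n)).span_eq, Submodule.span_le]
    rintro _ ⟨i, rfl⟩
    convert! hmem (Pi.single i 1) using 1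
    ext j
    by_cases hij : j = i
    · subst hij
      simp [ψ]
    · simp [ψ, hij]
  obtain ⟨κ, a, _, hsp, hli⟩ := exists_linearIndependent' K v
  let b := Module.Basis.mk hli (by rw [hsp, htop])
  let e := b.indexEquiv (Pi.basisFun K (Fin n))
  refine ⟨Matrix.of fun i j => (a (e.symm j)).1 i, fun j => (a (e.symm j)).2, ?_⟩
  rw [← Ideal.algebraMap_residueField_eq_zero, RingHom.map_det, ← Matrix.det_transpose]
  have hli' := hli.comp e.symm e.symm.injective
  have hunit : IsUnit (Matrix.of fun j i => v (a (e.symm j)) i) :=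
    Matrix.linearIndependent_rows_iff_isUnit.mp hli'
  exact ((Matrix.isUnit_iff_isUnit_det _).mp hunit).ne_zero

section Connection

variable {k A : Type*} [CommRing k] [CommRing A] [Algebra k A] {n : ℕ}

theorem matConn_apply (D : Derivation k A A) (W : Matrix (Fin n) (Fin n) A) (v : Fin n → A)
    (i : Fin n) : matConn D W v i = D (v i) + ∑ j, W i j * v j := rfl

theorem matConn_smul (D : Derivation k A A) (W : Matrix (Fin n) (Fin n) A) (a : A)
    (v : Fin n → A) : matConn D W (a • v) = D a • v + a • matConn D W v := by
  ext i
  simp only [matConn_apply, Pi.add_apply, Pi.smul_apply, smul_eq_mul, Derivation.leibniz, mul_add,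
    Finset.mul_sum, mul_left_comm]
  ring

theorem matConn_zero (Ω : Matrix (Fin n) (Fin n) (Ω[A⁄k])) :
    matConn (0 : Derivation k A A) (matOfForms Ω 0) = 0 := by
  have h : (0 : Derivation k A A).liftKaehlerDifferential = 0 :=
    Derivation.liftKaehlerDifferential_unique _ _ (by ext a; simp)
  ext v i
  simp [matConn_apply, matOfForms, h]

/-- A matrix `Ω` of `1`-forms defines a flat connection with vanishing `p`-curvature. -/
def IsFlatPCurvatureZero (p : ℕ) (Ω : Matrix (Fin n) (Fin n) (Ω[A⁄k])) : Prop :=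
  (∀ D D' : Derivation k A A,
    matConn (⁅D, D'⁆ : Derivation k A A) (matOfForms Ω ⁅D, D'⁆)
      = matConn D (matOfForms Ω D) * matConn D' (matOfForms Ω D')
        - matConn D' (matOfForms Ω D') * matConn D (matOfForms Ω D)) ∧
  (∀ D D' : Derivation k A A, (D' : A →ₗ[k] A) = (D : A →ₗ[k] A) ^ p →
    matConn D (matOfForms Ω D) ^ p = matConn D' (matOfForms Ω D'))

/-- The total covariant derivative `dv + Ω v`. -/
noncomputable def covDeriv (Ω : Matrix (Fin n) (Fin n) (Ω[A⁄k])) (v : Fin n → A) (i : Fin n) :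
    Ω[A⁄k] :=
  KaehlerDifferential.D k A (v i) + ∑ j, v j • Ω i j

theorem liftKaehlerDifferential_covDeriv (Ω : Matrix (Fin n) (Fin n) (Ω[A⁄k]))
    (D : Derivation k A A) (v : Fin n → A) (i : Fin n) :
    D.liftKaehlerDifferential (covDeriv Ω v i) = matConn D (matOfForms Ω D) v i := by
  simp [covDeriv, matConn_apply, matOfForms, mul_comm]

end Connection

/-- Near a prime, a flat connection with vanishing `p`-curvature has a fundamental matrix of
horizontal sections. -/
theorem IsFlatPCurvatureZero.exists_horizontal_matrix {k A : Type u} [Field k] {p : ℕ}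
    [Fact p.Prime] [CharP k p] [CommRing A] [Algebra k A] [Algebra.Smooth k A] {n : ℕ}
    {Ω : Matrix (Fin n) (Fin n) (Ω[A⁄k])} (h : IsFlatPCurvatureZero p Ω)
    (P : Ideal A) [hP : P.IsPrime] :
    ∃ F : Matrix (Fin n) (Fin n) A, (∀ j, covDeriv Ω (fun i => F i j) = 0) ∧ F.det ∉ P := by
  obtain ⟨κ, _, _, x, E, g, hgP, hx, hg, hcomm, hnil, hspan⟩ :=
    Algebra.Smooth.exists_commuting_derivations (k := k) p P
  refine Matrix.exists_det_notMem_of_span P (H := {v | covDeriv Ω v = 0}) fun v => ?_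
  obtain ⟨N, hN⟩ := Derivation.exists_pow_smul_mem_span_horizontal p hx hg
    (T := fun i => matConn (E i) (matOfForms Ω (E i))) (fun i => matConn_smul _ _)
    (fun i j v => by
      have h1 := DFunLike.congr_fun (h.1 (E i) (E j)) v
      rw [hcomm, matConn_zero] at h1
      exact (sub_eq_zero.mp h1.symm))
    (fun i v => by
      have h1 := h.2 (E i) 0 (by rw [hnil]; rfl)
      rw [h1, matConn_zero]
      rfl) v
  refine ⟨g ^ p * g ^ N, fun hmem => hgP (hP.mem_of_pow_mem _ (by rwa [← pow_add] at hmem)), ?_⟩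
  have hle : Submodule.span A {w | ∀ i, matConn (E i) (matOfForms Ω (E i)) w = 0} ≤
      (Submodule.span A {v | covDeriv Ω v = 0}).comap (LinearMap.lsmul A _ (g ^ p)) := by
    refine Submodule.span_le.mpr fun w hw => Submodule.subset_span ?_
    ext i
    have h0 : g • covDeriv Ω w i = 0 := by
      rw [hspan]
      refine Finset.sum_eq_zero fun l _ => ?_
      rw [liftKaehlerDifferential_covDeriv, hw l, Pi.zero_apply, zero_smul]
    have h1 : covDeriv Ω (g ^ p • w) i = g ^ p • covDeriv Ω w i := by
      simp [covDeriv, (KaehlerDifferential.D k A).map_pow_prime p, Finset.smul_sum, mul_smul]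
    obtain ⟨q, hq⟩ := Nat.exists_eq_add_of_le (Fact.out : p.Prime).one_le
    rw [LinearMap.lsmul_apply, h1, hq, pow_add, pow_one, mul_comm, mul_smul, h0, smul_zero]
    rfl
  rw [mul_smul]
  exact hle hN

/-- A gauge transformation `K`, invertible near each prime, trivializing the connection, forces
flatness and vanishing `p`-curvature. -/
theorem isFlatPCurvatureZero_of_gauge {k A : Type*} [CommRing k] [CommRing A] [Algebra k A]
    {n : ℕ} (p : ℕ) {Ω : Matrix (Fin n) (Fin n) (Ω[A⁄k])}
    (h : ∀ P : Ideal A, P.IsPrime → ∃ K : Matrix (Fin n) (Fin n) A, K.det ∉ P ∧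
      ∀ i j, ∑ l, K i l • Ω l j = KaehlerDifferential.D k A (K i j)) :
    IsFlatPCurvatureZero p Ω := by
  have hext : ∀ v w : Fin n → A, (∀ K : Matrix (Fin n) (Fin n) A,
      (∀ i j, ∑ l, K i l • Ω l j = KaehlerDifferential.D k A (K i j)) →
      K.mulVec v = K.mulVec w) → v = w := by
    intro v w hvw
    ext i
    let I : Ideal A := Submodule.colon ⊥ {v i - w i}
    have hI : I = ⊤ := by
      by_contra hne
      obtain ⟨P, hP, hIP⟩ := Ideal.exists_le_maximal I hne
      obtain ⟨K, hK, hKΩ⟩ := h P hP.isPrime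
      refine hK (hIP ?_)
      have := congrArg (K.adjugate.mulVec) (hvw K hKΩ)
      simp only [Matrix.mulVec_mulVec, Matrix.adjugate_mul, Matrix.smul_mulVec,
        Matrix.one_mulVec] at this
      have := congrFun this i
      simp only [Pi.smul_apply, smul_eq_mul] at this
      simp [I, Submodule.mem_colon_singleton, mul_sub, this]
    have h1 : (1 : A) ∈ I := hI ▸ Submodule.mem_top
    simpa [I, Submodule.mem_colon_singleton, sub_eq_zero] using h1
  have hconj : ∀ K : Matrix (Fin n) (Fin n) A,
      (∀ i j, ∑ l, K i l • Ω l j = KaehlerDifferential.D k A (K i j)) →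
      ∀ (D : Derivation k A A) v,
        K.mulVec (matConn D (matOfForms Ω D) v) = fun i => D (K.mulVec v i) := by
    intro K hK D v
    ext i
    have h1 : ∀ j, D (K i j) = ∑ l, K i l * matOfForms Ω D l j := by
      intro j
      have := congrArg D.liftKaehlerDifferential (hK i j)
      simpa [matOfForms] using this.symm
    simp only [Matrix.mulVec, dotProduct, matConn_apply, map_sum, Derivation.leibniz, smul_eq_mul,
      h1, mul_add, Finset.sum_add_distrib, Finset.mul_sum]
    congr 1
    rw [Finset.sum_comm]
    exact Finset.sum_congr rfl fun _ _ => Finset.sum_congr rfl fun _ _ => by ring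
  refine ⟨fun D D' => ?_, fun D D' hD => ?_⟩
  · refine DFunLike.ext _ _ fun v => hext _ _ fun K hK => ?_
    change _ = K.mulVec (matConn D _ (matConn D' _ v) - matConn D' _ (matConn D _ v))
    rw [Matrix.mulVec_sub, hconj K hK, hconj K hK, hconj K hK, hconj K hK, hconj K hK]
    ext i
    simp [Derivation.commutator_apply]
  · refine DFunLike.ext _ _ fun v => hext _ _ fun K hK => ?_
    have hpow : ∀ m : ℕ, K.mulVec ((matConn D (matOfForms Ω D) ^ m) v)
        = fun i => ((D : A →ₗ[k] A) ^ m) (K.mulVec v i) := by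
      intro m
      induction m with
      | zero => rfl
      | succ m ih =>
        rw [pow_succ', AddMonoid.End.coe_mul, Function.comp_apply, hconj K hK, ih]
        ext i
        rw [pow_succ', Module.End.mul_apply]
        rfl
    rw [hpow, hconj K hK, ← hD]
    rfl

section Gauge

variable {k A B : Type*} [CommRing k] [CommRing A] [Algebra k A] [CommRing B] [Algebra k B]
  [Algebra A B] [IsScalarTower k A B] {n : ℕ}

/-- The inverse of a horizontal fundamental matrix exhibits `Ω` as a Maurer–Cartan form. -/
theorem map_eq_maurerCartan_of_horizontal {Ω : Matrix (Fin n) (Fin n) (Ω[A⁄k])}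
    {F : Matrix (Fin n) (Fin n) A} (hF : ∀ j, covDeriv Ω (fun i => F i j) = 0)
    {G : Matrix (Fin n) (Fin n) B} (hG : F.map (algebraMap A B) * G = 1) (i j : Fin n) :
    KaehlerDifferential.map k k A B (Ω i j)
      = ∑ l, F.map (algebraMap A B) i l • KaehlerDifferential.D k B (G l j) := by
  have hd : ∀ i l, KaehlerDifferential.D k B (F.map (algebraMap A B) i l)
      = -∑ m, F.map (algebraMap A B) m l • KaehlerDifferential.map k k A B (Ω i m) := by
    intro i l
    have := congrArg (KaehlerDifferential.map k k A B) (congrFun (hF l) i)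
    simp only [covDeriv, map_add, map_sum, map_smul, Pi.zero_apply, map_zero,
      KaehlerDifferential.map_D] at this
    rw [eq_neg_iff_add_eq_zero]
    simpa using this
  have h1 : KaehlerDifferential.D k B ((F.map (algebraMap A B) * G) i j) = 0 := by
    rw [hG, Matrix.one_apply]
    split_ifs <;> simp
  rw [Matrix.mul_apply, map_sum] at h1
  simp only [Derivation.leibniz, Finset.sum_add_distrib] at h1
  rw [eq_neg_of_add_eq_zero_left h1]
  simp only [hd, smul_neg, Finset.sum_neg_distrib, neg_neg, Finset.smul_sum, ← mul_smul]
  rw [Finset.sum_comm]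
  have h2 : ∀ m, ∑ l, G l j * F.map (algebraMap A B) m l = if m = j then 1 else 0 := by
    intro m
    rw [← Matrix.one_apply, ← hG, Matrix.mul_apply]
    exact Finset.sum_congr rfl fun _ _ => mul_comm _ _
  simp only [← Finset.sum_smul, h2, ite_smul, one_smul, zero_smul,
    Finset.sum_ite_eq', Finset.mem_univ, if_true]

end Gauge

/-- A trivialization of `Ω` over a localization yields, after clearing denominators by `p`-th
powers, a gauge transformation over the base ring. -/
theorem exists_gauge_of_maurerCartan {k A : Type u} [Field k] (p : ℕ) [Fact p.Prime] [CharP k p]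
    [CommRing A] [Algebra k A] {n : ℕ} {Ω : Matrix (Fin n) (Fin n) (Ω[A⁄k])}
    (P : Ideal A) [hP : P.IsPrime] {g : A} (hg : g ∉ P) {C : Type u} [CommRing C] [Algebra k C]
    [Algebra A C] [IsScalarTower k A C] [IsLocalization.Away g C]
    (G : (Matrix (Fin n) (Fin n) C)ˣ)
    (hG : ∀ i j, KaehlerDifferential.map k k A C (Ω i j)
      = ∑ l, ((G⁻¹ : (Matrix (Fin n) (Fin n) C)ˣ) :
          Matrix (Fin n) (Fin n) C) i l •
        KaehlerDifferential.D k C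
          ((G : Matrix (Fin n) (Fin n) C) l j)) :
    ∃ K : Matrix (Fin n) (Fin n) A, K.det ∉ P ∧
      ∀ i j, ∑ l, K i l • Ω l j = KaehlerDifferential.D k A (K i j) := by
  let S := Submonoid.powers g
  have hp : p - 1 + 1 = p := Nat.sub_add_cancel (Fact.out : p.Prime).one_le
  obtain ⟨b, hb⟩ := IsLocalization.exist_integer_multiples_of_finite S
    (fun ij : Fin n × Fin n => (G : Matrix (Fin n) (Fin n) C) ij.1 ij.2)
  choose K₀ hK₀ using hb
  let K₁ : Matrix (Fin n) (Fin n) A := Matrix.of fun i j => (b : A) ^ (p - 1) * K₀ (i, j)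
  have hK₁ : ∀ i j, algebraMap A C (K₁ i j)
      = algebraMap A C b ^ p * (G : Matrix (Fin n) (Fin n) C) i j := by
    intro i j
    have := hK₀ (i, j)
    simp only [Algebra.smul_def] at this
    simp only [K₁, Matrix.of_apply, map_mul, map_pow, this]
    conv_rhs => rw [← hp, pow_succ]
    ring
  have hGd : ∀ i j, ∑ l, (G : Matrix (Fin n) (Fin n) C) i l •
      KaehlerDifferential.map k k A C (Ω l j)
        = KaehlerDifferential.D k C ((G : Matrix (Fin n) (Fin n) C) i j) := by
    intro i j
    have h2 : ∀ m, ∑ l, (G : Matrix (Fin n) (Fin n) C) i l *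
        ((G⁻¹ : (Matrix (Fin n) (Fin n) C)ˣ) : Matrix (Fin n) (Fin n) C) l m
          = if i = m then 1 else 0 := by
      intro m
      rw [← Matrix.mul_apply, Units.mul_inv, Matrix.one_apply]
    simp only [hG, Finset.smul_sum, ← mul_smul]
    rw [Finset.sum_comm]
    simp only [← Finset.sum_smul, h2, ite_smul, one_smul, zero_smul, Finset.sum_ite_eq,
      Finset.mem_univ, if_true]
  have heq : ∀ i j, ∃ s : S, s • (∑ l, K₁ i l • Ω l j)
      = s • KaehlerDifferential.D k A (K₁ i j) := by
    intro i j
    apply IsLocalizedModule.exists_of_eq (S := S) (f := KaehlerDifferential.map k k A C)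
    rw [map_sum, KaehlerDifferential.map_D, hK₁, Derivation.leibniz,
      (KaehlerDifferential.D k C).map_pow_prime p, smul_zero, add_zero, ← hGd, Finset.smul_sum]
    refine Finset.sum_congr rfl fun l _ => ?_
    rw [map_smul, ← mul_smul, ← hK₁, algebraMap_smul]
  choose s hs using heq
  let t : S := ∏ i, ∏ j, s i j
  have ht : ∀ i j, (t : A) • (∑ l, K₁ i l • Ω l j)
      = (t : A) • KaehlerDifferential.D k A (K₁ i j) := by
    intro i j
    have : s i j ∣ t := (Finset.dvd_prod_of_mem _ (Finset.mem_univ j)).trans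
      (Finset.dvd_prod_of_mem (fun i => ∏ j, s i j) (Finset.mem_univ i))
    obtain ⟨q, hq⟩ := this
    have h1 := hs i j
    simp only [Submonoid.smul_def] at h1
    rw [hq, Submonoid.coe_mul, mul_comm, mul_smul, mul_smul, h1]
  refine ⟨(t : A) ^ p • K₁, fun hdet => ?_, fun i j => ?_⟩
  · have hS : ∀ u : S, (u : A) ∉ P := by
      rintro ⟨_, m, rfl⟩ h
      exact hg (hP.mem_of_pow_mem m h)
    have hunit : IsUnit (algebraMap A C ((t : A) ^ p • K₁).det) := by
      have hmap : (algebraMap A C).mapMatrix ((t : A) ^ p • K₁)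
          = (algebraMap A C t ^ p * algebraMap A C b ^ p) • (G : Matrix (Fin n) (Fin n) C) := by
        ext i j
        simp [hK₁, mul_assoc]
      rw [RingHom.map_det, hmap, Matrix.det_smul]
      refine (((IsLocalization.map_units C t).pow p).mul
        ((IsLocalization.map_units C b).pow p)).pow _ |>.mul ?_
      exact (Matrix.isUnit_iff_isUnit_det _).mp G.isUnit
    have hprime := IsLocalization.isPrime_of_isPrime_disjoint S C P hP
      (Set.disjoint_left.mpr fun u hu => hS ⟨u, hu⟩)
    exact hprime.ne_top (Ideal.eq_top_of_isUnit_mem _ (Ideal.mem_map_of_mem _ hdet) hunit)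
  · have h1 := congrArg (fun ω => (t : A) ^ (p - 1) • ω) (ht i j)
    simp only [← mul_smul, ← pow_succ, hp] at h1
    simp only [Matrix.smul_apply, smul_eq_mul, Derivation.leibniz,
      (KaehlerDifferential.D k A).map_pow_prime p, smul_zero, add_zero]
    rw [← h1, Finset.smul_sum]
    simp only [mul_smul]

/-- **`GL_n`-connections trivialized by Frobenius, de Rham description.**
Let `k` be a perfect field of characteristic `p`, `A` a smooth `k`-algebra, `n ≥ 1` and `Ω`
an `n × n` matrix of `1`-forms. The connection `∇_D v = D(v) + Ω(D) · v` on `Aⁿ` is flat with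
vanishing `p`-curvature if and only if for every prime ideal `𝔭` of `A` there are `g ∉ 𝔭`
and an invertible matrix `G` over `A_g` such that the image of `Ω` in `Ω¹_{A_g/k}` equals
`G⁻¹ · dG`, i.e. its `(i,j)` entry is `∑ l, (G⁻¹)_{i l} • d(G_{l j})`. -/
theorem gl_flat_vanishing_p_curvature_iff_locally_maurer_cartan
    {k A : Type u} [Field k] [PerfectField k] (p : ℕ) [Fact p.Prime] [CharP k p]
    [CommRing A] [Algebra k A] [Algebra.Smooth k A]
    (n : ℕ) (hn : 1 ≤ n) (Ω : Matrix (Fin n) (Fin n) (Ω[A⁄k])) :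
    ((∀ D D' : Derivation k A A,
        matConn (⁅D, D'⁆ : Derivation k A A) (matOfForms Ω ⁅D, D'⁆)
          = matConn D (matOfForms Ω D) * matConn D' (matOfForms Ω D')
            - matConn D' (matOfForms Ω D') * matConn D (matOfForms Ω D)) ∧
      (∀ D D' : Derivation k A A, (D' : A →ₗ[k] A) = (D : A →ₗ[k] A) ^ p →
        matConn D (matOfForms Ω D) ^ p = matConn D' (matOfForms Ω D')))
    ↔ (∀ P : Ideal A, P.IsPrime → ∃ g : A, g ∉ P ∧
        ∃ G : (Matrix (Fin n) (Fin n) (Localization.Away g))ˣ, ∀ i j,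
          KaehlerDifferential.map k k A (Localization.Away g) (Ω i j)
            = ∑ l, ((G⁻¹ : (Matrix (Fin n) (Fin n) (Localization.Away g))ˣ) :
                  Matrix (Fin n) (Fin n) (Localization.Away g)) i l •
                KaehlerDifferential.D k (Localization.Away g)
                  (((G : (Matrix (Fin n) (Fin n) (Localization.Away g))ˣ) :
                    Matrix (Fin n) (Fin n) (Localization.Away g)) l j)) := by
  constructor
  · intro h P hP
    obtain ⟨F, hF, hdet⟩ := IsFlatPCurvatureZero.exists_horizontal_matrix (p := p) h P
    have hunit : IsUnit (F.map (algebraMap A (Localization.Away F.det))) := by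
      rw [Matrix.isUnit_iff_isUnit_det]
      change IsUnit ((algebraMap A _).mapMatrix F).det
      rw [← RingHom.map_det]
      exact IsLocalization.Away.algebraMap_isUnit _
    obtain ⟨U, hU⟩ := hunit
    refine ⟨F.det, hdet, U⁻¹, fun i j => ?_⟩
    rw [inv_inv, hU]
    exact map_eq_maurerCartan_of_horizontal hF (by rw [← hU, Units.mul_inv]) i j
  · intro h
    refine isFlatPCurvatureZero_of_gauge p fun P hP => ?_
    obtain ⟨g, hg, G, hG⟩ := h P hP
    exact exists_gauge_of_maurerCartan p P hg G hG
end

section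
/- Hochschild's identity in characteristic p (the computation underlying the p-curvature of rank-one connections in Proposition 4.6): let A be a commutative ring of prime characteristic p, let D : A → A be a derivation, and let a ∈ A. Then, as additive endomorphisms of A, (D + a·)^p = D^p + (a^p + D^{p−1}(a))·, where b· denotes multiplication by b and powers denote iterated composition. -/
/-!
Hochschild's identity in characteristic `p`: `(D + a·)^p = D^p + (a^p + D^{p-1}(a))·` for a
derivation `D` of a commutative ring `A` of characteristic `p`.
-/

universe u

/-- Multiplication by `a` as an additive endomorphism of `A`. -/
def mulLeftEnd {A : Type u} [CommRing A] (a : A) : AddMonoid.End A :=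
  AddMonoidHom.mulLeft a

section

open Polynomial Finset

/-- The derivative of a power in a noncommutative polynomial ring, when the iterated commutators
of `f` with its derivative `b 0` are given by the sequence `b`. -/
theorem derivative_pow_eq_sum_choose {R : Type*} [Ring R] (f : R[X]) (b : ℕ → R[X])
    (hf : derivative f = b 0) (hb : ∀ j, f * b j = b j * f + b (j + 1)) (n : ℕ) :
    derivative (f ^ n) = ∑ j ∈ range n, (n.choose (j + 1) : R[X]) * (b j * f ^ (n - 1 - j)) := by
  induction n with
  | zero => simp
  | succ n ih =>
    have hstep : ∀ j ∈ range n, f * ((n.choose (j + 1) : R[X]) * (b j * f ^ (n - 1 - j))) =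
        (n.choose (j + 1) : R[X]) * (b j * f ^ (n - j)) +
          (n.choose (j + 1) : R[X]) * (b (j + 1) * f ^ (n - (j + 1))) := by
      intro j hj
      have hjn : n - j = n - 1 - j + 1 := by have := mem_range.mp hj; omega
      rw [← mul_assoc, ← (Nat.cast_commute _ f).eq, mul_assoc, ← mul_assoc f, hb, hjn, pow_succ',
        show n - (j + 1) = n - 1 - j by omega]
      noncomm_ring
    have hpascal : ∀ j, ((n + 1).choose (j + 1) : R[X]) * (b j * f ^ (n - j)) =
        (n.choose j : R[X]) * (b j * f ^ (n - j)) +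
          (n.choose (j + 1) : R[X]) * (b j * f ^ (n - j)) := by
      intro j
      rw [Nat.choose_succ_succ, Nat.cast_add, add_mul]
    rw [pow_succ', derivative_mul, ih, hf, mul_sum, sum_congr rfl hstep, sum_add_distrib,
      Nat.add_sub_cancel, sum_congr rfl fun j _ => hpascal j, sum_add_distrib,
      sum_range_succ' (fun j => (n.choose j : R[X]) * (b j * f ^ (n - j))),
      sum_range_succ (fun j => (n.choose (j + 1) : R[X]) * (b j * f ^ (n - j)))]
    simp only [Nat.choose_succ_self, Nat.choose_zero_right, Nat.cast_zero, Nat.cast_one, zero_mul,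
      one_mul, Nat.sub_zero, add_zero]
    abel

/-- In characteristic `p` only the last iterated commutator contributes to the derivative of a
`p`-th power. -/
theorem derivative_pow_char {R : Type*} [Ring R] (p : ℕ) [hp : Fact p.Prime] [CharP R p]
    (f : R[X]) (b : ℕ → R[X]) (hf : derivative f = b 0)
    (hb : ∀ j, f * b j = b j * f + b (j + 1)) :
    derivative (f ^ p) = b (p - 1) := by
  have hp1 : p - 1 + 1 = p := Nat.sub_add_cancel hp.out.one_le
  rw [derivative_pow_eq_sum_choose f b hf hb, sum_eq_single_of_mem (p - 1)]
  · simp [hp1]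
  · simpa using hp.out.pos
  · intro j hj hne
    have hdvd : p ∣ p.choose (j + 1) :=
      hp.out.dvd_choose_self (by omega) (by have := mem_range.mp hj; omega)
    rw [(CharP.cast_eq_zero_iff R[X] p _).mpr hdvd, zero_mul]

/-- If the iterated commutators of `x` and of `y` with `y` are given by the sequence `c`, then
`(x + y) ^ p = x ^ p + y ^ p + c (p - 1)` in characteristic `p`: a special case of Jacobson's
formula. -/
theorem add_pow_char_of_iterated_commutators {R : Type*} [Ring R] (p : ℕ) [hp : Fact p.Prime]
    [CharP R p] (x : R) (c : ℕ → R) (hx : ∀ j, x * c j = c j * x + c (j + 1))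
    (hc : ∀ j, Commute (c 0) (c j)) :
    (x + c 0) ^ p = x ^ p + (c 0 ^ p + c (p - 1)) := by
  have hp2 := hp.out.two_le
  set f : R[X] := C x + C (c 0) * X with hf
  have hder : derivative (f ^ p) = C (c (p - 1)) := by
    refine derivative_pow_char p f (fun j => C (c j)) (by simp [hf]) fun j => ?_
    have hcj : C (c 0) * X * C (c j) = C (c j) * (C (c 0) * X) := by
      rw [mul_assoc, X_mul_C, ← mul_assoc, ← mul_assoc, ← C_mul, ← C_mul, (hc j).eq]
    rw [hf, add_mul, mul_add, hcj, ← C_mul, hx, C_add, C_mul]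
    abel
  have hdeg : f.natDegree ≤ 1 := by
    rw [hf, add_comm]
    exact natDegree_linear_le
  have hpow : f ^ p = C (x ^ p) + (C (c 0 ^ p) * X ^ p + C (c (p - 1)) * X) := by
    ext n
    have hcoeff : ∀ m, (f ^ p).coeff (m + 1) * ((m : R) + 1) = (C (c (p - 1))).coeff m :=
      fun m => by rw [← hder, coeff_derivative]
    rcases lt_trichotomy n p with hn | rfl | hn
    · rcases n with _ | _ | m
      · have h0 : (f ^ p).coeff 0 = x ^ p := by
          change constantCoeff (f ^ p) = x ^ p
          rw [map_pow]
          simp [hf]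
        simp [h0, coeff_X_pow, hn.ne, -map_pow]
      · have h1 := hcoeff 0
        simp only [Nat.cast_zero, zero_add, mul_one, coeff_C_zero] at h1
        simp [h1, coeff_X_pow, hn.ne, -map_pow]
      · have hunit : IsUnit ((m + 1 + 1 : ℕ) : R) :=
          (CharP.isUnit_natCast_iff hp.out).mpr
            (Nat.not_dvd_of_pos_of_lt (Nat.succ_pos _) hn)
        have h2 := hcoeff (m + 1)
        rw [coeff_C_succ, ← Nat.cast_succ, hunit.mul_left_eq_zero] at h2
        simp [h2, coeff_X_pow, hn.ne, -map_pow]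
    · have hn := coeff_pow_of_natDegree_le (m := n) hdeg
      rw [mul_one, show f.coeff 1 = c 0 by simp [hf, coeff_C]] at hn
      simp [hn, coeff_C, coeff_X, show n ≠ 0 by omega, show 1 ≠ n by omega, -map_pow]
    · rw [coeff_eq_zero_of_natDegree_lt ((natDegree_pow_le_of_le p hdeg).trans_lt (by omega))]
      simp [coeff_X_pow, coeff_C, coeff_X, hn.ne', show n ≠ 0 by omega, show 1 ≠ n by omega,
        -map_pow]
  have heval := congrArg
    (eval₂RingHom' (RingHom.id R) 1 fun a => Commute.one_right a) hpow
  rw [map_pow] at heval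
  simpa [hf, eval₂RingHom', -map_pow] using heval

end

theorem mulLeftEnd_add {A : Type u} [CommRing A] (a b : A) :
    mulLeftEnd (a + b) = mulLeftEnd a + mulLeftEnd b :=
  map_add AddMonoidHom.mul a b

theorem mulLeftEnd_mul {A : Type u} [CommRing A] (a b : A) :
    mulLeftEnd (a * b) = mulLeftEnd a * mulLeftEnd b :=
  AddMonoidHom.ext fun c => mul_assoc a b c

theorem mulLeftEnd_pow {A : Type u} [CommRing A] (a : A) (n : ℕ) :
    mulLeftEnd (a ^ n) = mulLeftEnd a ^ n := by
  induction n with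
  | zero =>
    rw [pow_zero, pow_zero]
    exact AddMonoidHom.ext one_mul
  | succ n ih => rw [pow_succ, pow_succ, mulLeftEnd_mul, ih]

theorem charP_addMonoidEnd {A : Type u} [CommRing A] (p : ℕ) [CharP A p] :
    CharP (AddMonoid.End A) p where
  cast_eq_zero_iff n := by
    rw [← CharP.cast_eq_zero_iff A p n]
    constructor
    · intro h
      simpa using DFunLike.congr_fun h (1 : A)
    · intro h
      refine AddMonoidHom.ext fun c => ?_
      change n • c = 0
      rw [nsmul_eq_mul, h, zero_mul]

/-- **Hochschild's identity.** Let `A` be a commutative ring of prime characteristic `p`,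
`D` an additive endomorphism of `A` satisfying the Leibniz rule, and `a ∈ A`. Then, as
additive endomorphisms of `A`, `(D + a·)^p = D^p + (a^p + D^{p−1}(a))·`. -/
theorem hochschild_identity {A : Type u} [CommRing A] (p : ℕ) [Fact p.Prime] [CharP A p]
    (D : AddMonoid.End A) (hD : ∀ a b : A, D (a * b) = a * D b + b * D a) (a : A) :
    (D + mulLeftEnd a) ^ p = D ^ p + mulLeftEnd (a ^ p + (D ^ (p - 1)) a) := by
  have := charP_addMonoidEnd (A := A) p
  have key := add_pow_char_of_iterated_commutators p D (fun j => mulLeftEnd ((D ^ j) a))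
    (fun j => AddMonoidHom.ext fun b => ?_) fun j => ?_
  · rw [mulLeftEnd_add, mulLeftEnd_pow]
    exact key
  · change D ((D ^ j) a * b) = (D ^ j) a * D b + (D ^ (j + 1)) a * b
    rw [hD, pow_succ', mul_comm b]
    rfl
  · rw [Commute, SemiconjBy, ← mulLeftEnd_mul, ← mulLeftEnd_mul, mul_comm]
end

section
/- p-linearity of the p-curvature of a flat connection (affine form of the fact cited from [Langer, Lemma 4.9]): let M be an A-module and ∇ a flat connection on M. For k-derivations D, D' of A such that the underlying linear map of D' equals the p-th iterate of that of D, write ψ(D,D') = (∇_D)^p − ∇_{D'}. Then: (i) ψ(D,D') is A-linear, i.e., ψ(D,D')(a·m) = a·ψ(D,D')(m) for all a ∈ A, m ∈ M; (ii) ψ is additive: if (D,D'), (E,E') and (D+E,F') are three such pairs, then ψ(D+E,F') = ψ(D,D') + ψ(E,E'); (iii) ψ is p-homogeneous: if a ∈ A and (D,D'), (a·D,E') are two such pairs, then ψ(a·D,E') = a^p·ψ(D,D'). -/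
/-!
`p`-linearity of the `p`-curvature of a flat connection: `ψ(D) = (∇_D)^p − ∇_{D^{[p]}}` is
`A`-linear as an endomorphism, additive in `D`, and `p`-homogeneous in `D`.
-/

universe u v

open Polynomial

/-- The inner derivation `y ↦ x * y - y * x` of an associative algebra. -/
def commutatorMap (k : Type*) {R : Type*} [Field k] [Ring R] [Algebra k R] (x : R) :
    Module.End k R :=
  LinearMap.mulLeft k x - LinearMap.mulRight k x

@[simp]
theorem commutatorMap_apply (k : Type*) {R : Type*} [Field k] [Ring R] [Algebra k R] (x y : R) :
    commutatorMap k x y = x * y - y * x := by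
  simp [commutatorMap]

/-- In an associative algebra of characteristic `p`, the commutator with `x ^ p` is the `p`-th
iterate of the commutator with `x`. -/
theorem commutatorMap_pow_char (k : Type*) {R : Type*} [Field k] (p : ℕ) [Fact p.Prime]
    [CharP k p] [Ring R] [Algebra k R] (x : R) :
    commutatorMap k (x ^ p) = commutatorMap k x ^ p := by
  cases subsingleton_or_nontrivial R
  · exact LinearMap.ext fun _ ↦ Subsingleton.elim _ _
  have : CharP (Module.End k R) p :=
    charP_of_injective_algebraMap (algebraMap k (Module.End k R)).injective p
  rw [commutatorMap, commutatorMap,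
    sub_pow_char_of_commute p (LinearMap.commute_mulLeft_right x x),
    LinearMap.pow_mulLeft, LinearMap.pow_mulRight]

theorem mul_pow_char_sub_pow_char_mul (k : Type*) {R : Type*} [Field k] (p : ℕ) [Fact p.Prime]
    [CharP k p] [Ring R] [Algebra k R] (x y : R) :
    y * x ^ p - x ^ p * y = (commutatorMap k x ^ (p - 1)) (y * x - x * y) := by
  have hp : p = p - 1 + 1 := (Nat.succ_pred_prime Fact.out).symm
  have h : y * x ^ p - x ^ p * y = -(commutatorMap k x ^ p) y := by
    rw [← commutatorMap_pow_char, commutatorMap_apply, neg_sub]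
  rw [h]
  conv_lhs => rw [hp, pow_succ, Module.End.mul_apply, commutatorMap_apply, ← map_neg, neg_sub]

/-- The inhomogeneous part of the noncommutative binomial expansion of `(x + y) ^ p` lies in
every subspace closed under commutators and containing `x` and `y`. -/
theorem add_pow_char_sub_sub_mem {k R : Type*} [Field k] (p : ℕ) [Fact p.Prime] [CharP k p]
    [Ring R] [Algebra k R] (S : Submodule k R)
    (hS : ∀ x ∈ S, ∀ y ∈ S, x * y - y * x ∈ S) {x y : R} (hx : x ∈ S) (hy : y ∈ S) :
    (x + y) ^ p - x ^ p - y ^ p ∈ S := by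
  have hp : p.Prime := Fact.out
  set u : R[X] := C x * X + C y with hu
  let d : Module.End k R[X] := derivative.restrictScalars k
  have hdu : d * LinearMap.mulLeft k u - LinearMap.mulLeft k u * d = LinearMap.mulLeft k (C x) := by
    ext1 f
    simp [d, hu, derivative_mul]
  have had (n : ℕ) (f : R[X]) :
      (commutatorMap k (LinearMap.mulLeft k u) ^ n) (LinearMap.mulLeft k f) =
        LinearMap.mulLeft k ((commutatorMap k u ^ n) f) := by
    induction n with
    | zero => simp
    | succ n ih =>
      rw [pow_succ', pow_succ', Module.End.mul_apply, ih, Module.End.mul_apply]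
      ext1 g
      simp [sub_mul, mul_assoc]
  have hder : derivative (u ^ p) = (commutatorMap k u ^ (p - 1)) (C x) := by
    have h := mul_pow_char_sub_pow_char_mul k p (LinearMap.mulLeft k u) d
    rw [hdu, had, LinearMap.pow_mulLeft] at h
    simpa [d] using LinearMap.congr_fun h 1
  have hmem (n : ℕ) : ∀ i, ((commutatorMap k u ^ n) (C x)).coeff i ∈ S := by
    induction n with
    | zero =>
      intro i
      simp only [pow_zero, Module.End.one_apply, coeff_C]
      split_ifs
      exacts [hx, S.zero_mem]
    | succ n ih =>
      intro i
      rw [pow_succ', Module.End.mul_apply, commutatorMap_apply]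
      generalize (commutatorMap k u ^ n) (C x) = f at ih
      have hy' : y * f.coeff i - f.coeff i * y ∈ S := hS _ hy _ (ih i)
      cases i with
      | zero =>
        convert hy' using 1
        simp [hu, mul_coeff_zero]
      | succ i =>
        convert S.add_mem (hS _ hx _ (ih i)) hy' using 1
        simp only [hu, add_mul, mul_add, coeff_sub, coeff_add, mul_assoc, coeff_C_mul,
          X_mul, coeff_mul_X, coeff_mul_C]
        simp only [← mul_assoc, coeff_mul_X, coeff_mul_C]
        abel
  have hcoeff (i : ℕ) (hi : i + 1 < p) : (u ^ p).coeff (i + 1) ∈ S := by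
    have h := hmem (p - 1) i
    rw [← hder, coeff_derivative] at h
    have hk : ((i + 1 : ℕ) : k) ≠ 0 := by
      rw [Ne, CharP.cast_eq_zero_iff k p]
      exact Nat.not_dvd_of_pos_of_lt i.succ_pos hi
    have h2 := S.smul_mem ((i + 1 : ℕ) : k)⁻¹ h
    have h3 : (u ^ p).coeff (i + 1) * ((i : R) + 1) =
        ((i + 1 : ℕ) : k) • (u ^ p).coeff (i + 1) := by
      rw [Nat.cast_smul_eq_nsmul, nsmul_eq_mul, Nat.cast_comm, Nat.cast_succ]
    rwa [h3, inv_smul_smul₀ hk] at h2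
  have hdeg : u.natDegree ≤ 1 := by
    rw [hu]; compute_degree
  have hdegp : (u ^ p).natDegree < p + 1 := by
    have := natDegree_pow_le_of_le p hdeg
    lia
  have heval : eval 1 (u ^ p) = (x + y) ^ p := by
    have h : eval 1 (u ^ p) = eval 1 u ^ p :=
      map_pow (eval₂RingHom' (RingHom.id R) 1 fun a ↦ Commute.one_right a) u p
    have hu1 : eval 1 u = x + y := by simp [hu]
    rw [h, hu1]
  have htop : (u ^ p).coeff p = x ^ p := by
    simpa [hu] using coeff_pow_of_natDegree_le (m := p) hdeg
  have hzero (n : ℕ) : (u ^ n).coeff 0 = y ^ n := by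
    induction n with
    | zero => simp
    | succ n ih => rw [pow_succ, mul_coeff_zero, ih, pow_succ]; simp [hu]
  have hsum : (x + y) ^ p - x ^ p - y ^ p = ∑ i ∈ Finset.range (p - 1), (u ^ p).coeff (i + 1) := by
    rw [← heval, eval_eq_sum_range' hdegp, Finset.sum_range_succ, htop]
    obtain ⟨q, rfl⟩ : ∃ q, p = q + 1 := ⟨p - 1, (Nat.succ_pred_prime hp).symm⟩
    rw [Finset.sum_range_succ', hzero]
    simp
  rw [hsum]
  refine sum_mem fun i hi ↦ hcoeff i ?_
  rw [Finset.mem_range] at hi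
  lia

/-- **Hochschild's formula.** If `x` acts on an `A`-module by the Leibniz rule with respect to a
derivation `D`, then `(a x) ^ p = a ^ p x ^ p + (a D) ^ (p - 1) (a) x` in characteristic `p`. -/
theorem smul_pow_char {k A M : Type*} [Field k] (p : ℕ) [Fact p.Prime] [CharP k p]
    [CommRing A] [Algebra k A] [AddCommGroup M] [Module k M] [Module A M] [IsScalarTower k A M]
    (D : Derivation k A A) (x : Module.End k M)
    (hx : ∀ (a : A) (m : M), x (a • m) = D a • m + a • x m) (a : A) (m : M) :
    ((Algebra.lsmul k k M a * x) ^ p) m =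
      a ^ p • (x ^ p) m + (((a • D : Derivation k A A) : A →ₗ[k] A) ^ (p - 1)) a • x m := by
  have hp : p.Prime := Fact.out
  set u : A →ₗ[k] A := ((a • D : Derivation k A A) : A →ₗ[k] A) with hu
  have hu' (b : A) : u b = a * D b := rfl
  let U : Module.End k A[X] := lsum fun n ↦ ((monomial n).restrictScalars k).comp u
  have hU (n : ℕ) (b : A) : U (monomial n b) = monomial n (u b) := by
    simp [U, lsum, sum_monomial_index]
  let W : Module.End k A[X] := U + LinearMap.mulLeft k (C a * X)
  let d : Module.End k A[X] := derivative.restrictScalars k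
  have hUcoeff (f : A[X]) (i : ℕ) : (U f).coeff i = u (f.coeff i) := by
    induction f using Polynomial.induction_on' with
    | add f g hf hg => simp [hf, hg]
    | monomial n b =>
      rw [hU, coeff_monomial, coeff_monomial]
      split_ifs <;> simp
  have hdW : d * W - W * d = LinearMap.mulLeft k (C a) := by
    ext1 f
    have h : derivative (U f) = U (derivative f) := by
      ext i
      rw [coeff_derivative, hUcoeff, hUcoeff, coeff_derivative]
      simp only [hu']
      have : D ((i : A) + 1) = 0 := by simp
      simp [this]
      ring
    simp [d, W, derivative_mul, h]
    ring
  have had (n : ℕ) (b : A) : (commutatorMap k W ^ n) (LinearMap.mulLeft k (C b)) =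
      LinearMap.mulLeft k (C ((u ^ n) b)) := by
    induction n with
    | zero => simp
    | succ n ih =>
      rw [pow_succ', pow_succ', Module.End.mul_apply, ih, Module.End.mul_apply]
      ext f i
      generalize (u ^ n) b = c
      have hc : C a * X * (C c * f) = C c * (C a * X * f) := by ring
      simp only [W, commutatorMap_apply, LinearMap.sub_apply, Module.End.mul_apply,
        LinearMap.add_apply, LinearMap.mulLeft_apply, hc, mul_add, coeff_sub, coeff_add, hUcoeff,
        coeff_C_mul, hu', Derivation.leibniz, smul_eq_mul]
      ring
  have hder : derivative ((W ^ p) 1) = C ((u ^ (p - 1)) a) := by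
    have hd1 : (W ^ p) (d 1) = 0 := by simp [d]
    have h := mul_pow_char_sub_pow_char_mul k p W d
    rw [hdW, had] at h
    have h1 := LinearMap.congr_fun h 1
    rw [LinearMap.sub_apply, Module.End.mul_apply, Module.End.mul_apply, hd1] at h1
    simpa [d] using h1
  have hzero (n : ℕ) : ((W ^ (n + 1)) 1).coeff 0 = 0 := by
    induction n with
    | zero => simp [W, hUcoeff, hu']
    | succ n ih =>
      rw [pow_succ', Module.End.mul_apply]
      generalize (W ^ (n + 1)) 1 = f at ih
      simp [W, hUcoeff, ih, mul_coeff_zero]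
  have hdeg (n i : ℕ) (hi : n ≤ i) : ((W ^ n) 1).coeff i = if i = n then a ^ n else 0 := by
    induction n generalizing i with
    | zero => simp [coeff_one]
    | succ n ih =>
      obtain ⟨i, rfl⟩ : ∃ j, i = j + 1 := ⟨i - 1, by lia⟩
      rw [pow_succ', Module.End.mul_apply]
      simp only [W, LinearMap.add_apply, coeff_add, hUcoeff, LinearMap.mulLeft_apply, mul_assoc,
        coeff_C_mul, coeff_X_mul]
      rw [ih _ (by lia), ih _ (by lia), if_neg (by lia)]
      simp [pow_succ']
  have hW : (W ^ p) 1 = monomial p (a ^ p) + monomial 1 ((u ^ (p - 1)) a) := by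
    ext i
    rw [coeff_add, coeff_monomial, coeff_monomial]
    have hp1 := hp.one_lt
    rcases le_or_gt p i with hi | hi
    · rw [hdeg p i hi, if_neg (show 1 ≠ i by lia)]
      simp [eq_comm]
    rw [if_neg hi.ne', zero_add]
    cases i with
    | zero =>
      have h := hzero (p - 1)
      rw [Nat.sub_add_cancel hp.one_le] at h
      simp [h]
    | succ i =>
      have h := congr_arg (coeff · i) hder
      simp only [coeff_derivative, coeff_C] at h
      rcases Nat.eq_zero_or_pos i with rfl | hi0
      · simpa using h
      · rw [if_neg hi0.ne'] at h
        rw [if_neg (by lia)]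
        have hk : ((i + 1 : ℕ) : k) ≠ 0 := by
          rw [Ne, CharP.cast_eq_zero_iff k p]
          exact Nat.not_dvd_of_pos_of_lt i.succ_pos hi
        have hA : IsUnit ((i : A) + 1) := by
          simpa using (IsUnit.mk0 _ hk).map (algebraMap k A)
        exact hA.mul_left_eq_zero.mp h
  let Φ : A[X] →ₗ[k] M :=
    lsum fun n ↦ (LinearMap.toSpanSingleton A M ((x ^ n) m)).restrictScalars k
  have hΦ (n : ℕ) (b : A) : Φ (monomial n b) = b • (x ^ n) m := by
    simp [Φ, lsum, sum_monomial_index]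
  have hΦW (f : A[X]) : Φ (W f) = (Algebra.lsmul k k M a * x) (Φ f) := by
    induction f using Polynomial.induction_on' with
    | add f g hf hg => simp only [map_add, hf, hg]
    | monomial n b =>
      have h : W (monomial n b) = monomial n (a * D b) + monomial (n + 1) (a * b) := by
        simp only [W, LinearMap.add_apply, hU, hu', LinearMap.mulLeft_apply,
          C_mul_X_eq_monomial, monomial_mul_monomial, add_comm 1 n]
      rw [h, map_add, hΦ, hΦ, hΦ, Module.End.mul_apply, hx]
      simp [pow_succ', mul_smul]
  have hΦpow (n : ℕ) : Φ ((W ^ n) 1) = ((Algebra.lsmul k k M a * x) ^ n) m := by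
    induction n with
    | zero =>
      have := hΦ 0 1
      simpa using this
    | succ n ih => rw [pow_succ', pow_succ', Module.End.mul_apply, hΦW, ih, ← Module.End.mul_apply]
  rw [← hΦpow, hW, map_add, hΦ, hΦ, pow_one]

/-- **`p`-linearity of the `p`-curvature.**
Let `k` be a field of characteristic `p`, `A` a commutative `k`-algebra, and `∇` a flat
connection on an `A`-module `M`. For derivations `D, D'` with `D'` equal (as a linear map)
to the `p`-th iterate of `D`, write `ψ(D,D') = (∇_D)^p − ∇_{D'}`. Then `ψ(D,D')` is
`A`-linear; `ψ` is additive; and `ψ(a·D, —) = a^p · ψ(D, —)`. -/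
theorem p_curvature_p_linear
    {k A : Type u} [Field k] (p : ℕ) [Fact p.Prime] [CharP k p]
    [CommRing A] [Algebra k A]
    (M : Type v) [AddCommGroup M] [Module k M] [Module A M] [IsScalarTower k A M]
    (nabla : Derivation k A A → Module.End k M)
    (hadd : ∀ D D' : Derivation k A A, nabla (D + D') = nabla D + nabla D')
    (hsmul : ∀ (a : A) (D : Derivation k A A) (m : M), nabla (a • D) m = a • nabla D m)
    (leibniz : ∀ (D : Derivation k A A) (a : A) (m : M),
      nabla D (a • m) = D a • m + a • nabla D m)
    (flat : ∀ D D' : Derivation k A A,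
      nabla ⁅D, D'⁆ = nabla D * nabla D' - nabla D' * nabla D) :
    (∀ D D' : Derivation k A A, (D' : A →ₗ[k] A) = (D : A →ₗ[k] A) ^ p →
      ∀ (a : A) (m : M),
        (nabla D ^ p - nabla D') (a • m) = a • (nabla D ^ p - nabla D') m) ∧
    (∀ D D' E E' F' : Derivation k A A,
      (D' : A →ₗ[k] A) = (D : A →ₗ[k] A) ^ p →
      (E' : A →ₗ[k] A) = (E : A →ₗ[k] A) ^ p →
      (F' : A →ₗ[k] A) = ((D + E : Derivation k A A) : A →ₗ[k] A) ^ p →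
      ∀ m : M,
        (nabla (D + E) ^ p - nabla F') m
          = (nabla D ^ p - nabla D') m + (nabla E ^ p - nabla E') m) ∧
    (∀ (a : A) (D D' E' : Derivation k A A),
      (D' : A →ₗ[k] A) = (D : A →ₗ[k] A) ^ p →
      (E' : A →ₗ[k] A) = ((a • D : Derivation k A A) : A →ₗ[k] A) ^ p →
      ∀ m : M,
        (nabla (a • D) ^ p - nabla E') m = a ^ p • (nabla D ^ p - nabla D') m) := by
  have hp : p.Prime := Fact.out
  have hlin (D D' : Derivation k A A) (hD : (D' : A →ₗ[k] A) = (D : A →ₗ[k] A) ^ p)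
      (a : A) (m : M) :
      (nabla D ^ p - nabla D') (a • m) = a • (nabla D ^ p - nabla D') m := by
    have had (n : ℕ) : (commutatorMap k (nabla D) ^ n) (Algebra.lsmul k k M a) =
        Algebra.lsmul k k M (((D : A →ₗ[k] A) ^ n) a) := by
      induction n with
      | zero => simp
      | succ n ih =>
        rw [pow_succ', pow_succ', Module.End.mul_apply, ih, Module.End.mul_apply]
        ext m
        simp [leibniz]
    have h := LinearMap.congr_fun (had p) m
    rw [← commutatorMap_pow_char, ← hD, commutatorMap_apply] at h
    simp only [LinearMap.sub_apply, Module.End.mul_apply, Algebra.lsmul_coe,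
      Derivation.coeFn_coe] at h
    rw [LinearMap.sub_apply, LinearMap.sub_apply, leibniz, smul_sub, ← h]
    abel
  refine ⟨hlin, ?_, ?_⟩
  · intro D D' E E' F' hD hE hF m
    have hsmul' (c : k) (D : Derivation k A A) : nabla (c • D) = c • nabla D := by
      ext m
      rw [← algebraMap_smul A c D, hsmul, LinearMap.smul_apply, algebraMap_smul]
    let graph : Derivation k A A →ₗ[k] Module.End k A × Module.End k M :=
      { toFun D := (D, nabla D)
        map_add' D E := Prod.ext rfl (hadd D E)
        map_smul' c D := Prod.ext rfl (hsmul' c D) }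
    have hlie : ∀ x ∈ LinearMap.range graph, ∀ y ∈ LinearMap.range graph,
        x * y - y * x ∈ LinearMap.range graph := by
      rintro _ ⟨D, rfl⟩ _ ⟨E, rfl⟩
      exact ⟨⁅D, E⁆, Prod.ext rfl (flat D E)⟩
    obtain ⟨G, hG⟩ := add_pow_char_sub_sub_mem p (LinearMap.range graph) hlie
      (LinearMap.mem_range_self graph D) (LinearMap.mem_range_self graph E)
    have hG1 : (G : A →ₗ[k] A) = ((D + E : Derivation k A A) : A →ₗ[k] A) ^ p -
      (D : A →ₗ[k] A) ^ p - (E : A →ₗ[k] A) ^ p := congr_arg Prod.fst hG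
    have hG2 : nabla G = (nabla D + nabla E) ^ p - nabla D ^ p - nabla E ^ p :=
      congr_arg Prod.snd hG
    rw [← hD, ← hE, ← hF] at hG1
    have hF' : F' = G + D' + E' := by
      ext b
      have h := LinearMap.congr_fun hG1 b
      simp only [LinearMap.sub_apply, Derivation.coeFn_coe] at h
      simp only [Derivation.add_apply, h]
      abel
    rw [← LinearMap.add_apply, hF', hadd, hadd, hadd, hG2]
    congr 1
    abel
  · intro a D D' E' hD hE m
    set b := (((a • D : Derivation k A A) : A →ₗ[k] A) ^ (p - 1)) a
    have hE' : E' = a ^ p • D' + b • D := by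
      ext c
      have h := smul_pow_char p D (D : A →ₗ[k] A) (fun a c ↦ by simp [mul_comm, add_comm]) a c
      have h1 : Algebra.lsmul k k A a * (D : A →ₗ[k] A) =
        ((a • D : Derivation k A A) : A →ₗ[k] A) := rfl
      rw [h1, ← hE, ← hD] at h
      exact h
    have h := smul_pow_char p D (nabla D) (leibniz D) a m
    have h1 : Algebra.lsmul k k M a * nabla D = nabla (a • D) := by
      ext m
      simp [hsmul]
    rw [h1] at h
    rw [LinearMap.sub_apply, h, hE', hadd, LinearMap.add_apply, hsmul, hsmul,
      LinearMap.sub_apply, smul_sub]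
    abel
end

section
/- Degree-zero part of Cartier's theorem (used for gluing in §1.1 and in the proof of Proposition 4.8): for a ∈ A, one has da = 0 in Ω¹_{A/k} if and only if a = b^p for some b ∈ A. -/
/-!
Degree-zero part of Cartier's theorem: for a smooth algebra over a perfect field of
characteristic `p`, `da = 0` if and only if `a` is a `p`-th power.
-/

universe u

open KaehlerDifferential

theorem Nat.Prime.dvd_descFactorial_add_pred {p n : ℕ} (hp : p.Prime) (hn : ¬ p ∣ n) :
    p ∣ (n + (p - 1)).descFactorial (p - 1) := by
  have h : p ∣ (n + (p - 1)).descFactorial (p - 1 + 1) := by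
    rw [Nat.sub_add_cancel hp.one_le]
    exact (Nat.dvd_factorial hp.pos le_rfl).trans (Nat.factorial_dvd_descFactorial _ _)
  rw [Nat.descFactorial_succ, Nat.add_sub_cancel] at h
  exact (hp.dvd_mul.mp h).resolve_left hn

section Derivation

variable {k A : Type*} [CommRing k] [CommRing A] [Algebra k A]

theorem Derivation.pow_apply_mul_pow_s12 (D : Derivation k A A) {x c : A} (hx : D x = 1)
    (hc : D c = 0) (m n : ℕ) :
    ((D : A →ₗ[k] A) ^ m) (c * x ^ n) = n.descFactorial m * (c * x ^ (n - m)) := by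
  induction m with
  | zero => simp
  | succ m ih =>
    rw [pow_succ', Module.End.mul_apply, ih, Derivation.coeFn_coe]
    simp only [Derivation.leibniz, Derivation.leibniz_pow, hx, hc, Derivation.map_natCast,
      smul_eq_mul, nsmul_eq_mul, Nat.descFactorial_succ, Nat.cast_mul, Nat.sub_sub]
    ring

theorem Derivation.map_pow_char (D : Derivation k A A) (p : ℕ) [CharP A p] (b : A) :
    D (b ^ p) = 0 := by
  simp [Derivation.leibniz_pow]

/-- If `D x = 1` and `D` vanishes on a subalgebra `C` containing the `p`-th powers, then every
constant of `D` in `C[x]` already lies in `C`. -/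
theorem Derivation.mem_of_mem_adjoin_of_apply_eq_zero (D : Derivation k A A) (p : ℕ)
    [Fact p.Prime] [CharP A p] (C : Subalgebra k A) (hpow : ∀ b : A, b ^ p ∈ C)
    (hC : ∀ c ∈ C, D c = 0) {x : A} (hx : D x = 1) {y : A} (hy : y ∈ Algebra.adjoin C {x})
    (hDy : D y = 0) : y ∈ C := by
  have hp : p.Prime := Fact.out
  have key : ∀ z ∈ Algebra.adjoin C {x},
      ((D : A →ₗ[k] A) ^ (p - 1)) (z * x ^ (p - 1)) ∈ C := by
    intro z hz
    rw [Algebra.adjoin_singleton_eq_range_aeval] at hz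
    obtain ⟨P, rfl⟩ := hz
    induction P using Polynomial.induction_on' with
    | add P Q hP hQ =>
      simp only [AlgHom.toRingHom_eq_coe, RingHom.coe_coe, map_add, add_mul] at hP hQ ⊢
      exact C.add_mem hP hQ
    | monomial n c =>
      simp only [AlgHom.toRingHom_eq_coe, RingHom.coe_coe, Polynomial.aeval_monomial, mul_assoc,
        ← pow_add]
      change ((D : A →ₗ[k] A) ^ (p - 1)) ((c : A) * x ^ (n + (p - 1))) ∈ C
      rw [D.pow_apply_mul_pow_s12 hx (hC _ c.2)]
      by_cases hn : p ∣ n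
      · obtain ⟨m, rfl⟩ := hn
        rw [Nat.add_sub_cancel, mul_comm p m, pow_mul]
        exact C.mul_mem (natCast_mem C _) (C.mul_mem c.2 (hpow _))
      · rw [(CharP.cast_eq_zero_iff A p _).mpr (hp.dvd_descFactorial_add_pred hn), zero_mul]
        exact C.zero_mem
  have h := key y hy
  have hw : ((p - 1).factorial : A) = -1 := by
    rw [← _root_.map_natCast (ZMod.castHom dvd_rfl A), ZMod.wilsons_lemma, _root_.map_neg, map_one]
  rw [D.pow_apply_mul_pow_s12 hx hDy, Nat.descFactorial_self, hw] at h
  simpa using h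

end Derivation

section PthPowers

variable {A : Type*} [CommRing A] (p : ℕ) [Fact p.Prime] [CharP A p]

/-- Being a `p`-th power is a Zariski-local property in characteristic `p`. -/
theorem exists_eq_pow_char_of_span_eq_top {s : Set A} (hs : Ideal.span s = ⊤) {a : A}
    (h : ∀ f ∈ s, ∃ c : Localization.Away f, algebraMap A _ a = c ^ p) : ∃ c : A, a = c ^ p := by
  let J : Ideal A :=
    { carrier := {f | ∃ c, f ^ p * a = c ^ p}
      zero_mem' := ⟨0, by simp [(Fact.out : p.Prime).ne_zero]⟩
      add_mem' := by
        rintro f g ⟨c, hc⟩ ⟨d, hd⟩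
        exact ⟨c + d, by rw [add_pow_char, add_pow_char, add_mul, hc, hd]⟩
      smul_mem' := by
        rintro r f ⟨c, hc⟩
        exact ⟨r * c, by rw [smul_eq_mul, mul_pow, mul_assoc, hc, mul_pow]⟩ }
  have hJ : J.radical = ⊤ := by
    rw [eq_top_iff, ← hs, Ideal.span_le]
    intro f hf
    obtain ⟨c, hc⟩ := h f hf
    obtain ⟨n, d, hd⟩ := IsLocalization.Away.surj f c
    have h1 : algebraMap A (Localization.Away f) ((f ^ n) ^ p * a) = algebraMap A _ (d ^ p) := by
      rw [map_mul, hc, map_pow, map_pow, ← mul_pow, mul_comm, hd, map_pow]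
    obtain ⟨m, hm⟩ := IsLocalization.Away.exists_of_eq f h1
    refine ⟨m + n, f ^ m * d, ?_⟩
    obtain ⟨q, hq⟩ : ∃ q, p = q + 1 := ⟨p - 1, by have := (Fact.out : p.Prime).one_le; omega⟩
    calc (f ^ (m + n)) ^ p * a = (f ^ m) ^ (p - 1) * (f ^ m * ((f ^ n) ^ p * a)) := by
          rw [hq, Nat.add_sub_cancel]; ring
      _ = (f ^ m * d) ^ p := by rw [hm, hq, Nat.add_sub_cancel]; ring
  obtain ⟨c, hc⟩ := (Ideal.eq_top_iff_one J).mp (Ideal.radical_eq_top.mp hJ)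
  exact ⟨c, by simpa using hc⟩

variable {k : Type*} [Field k] [Algebra k A]

/-- A finite type algebra in characteristic `p` is generated by its `p`-th powers together with
any set of elements whose differentials span. -/
theorem adjoin_pow_char_union_eq_top [Algebra.FiniteType k A] {s : Set A}
    (hs : Submodule.span A (D k A '' s) = ⊤) :
    Algebra.adjoin k (Set.range (fun b : A ↦ b ^ p) ∪ s) = ⊤ := by
  have hp : p.Prime := Fact.out
  nontriviality A
  set B := Algebra.adjoin k (Set.range (fun b : A ↦ b ^ p) ∪ s)
  have hpow (b : A) : b ^ p ∈ B := Algebra.subset_adjoin (Or.inl ⟨b, rfl⟩)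
  have : Algebra.FiniteType B A := .of_restrictScalars_finiteType k B A
  have : Algebra.IsIntegral B A := ⟨fun b ↦ .of_pow hp.pos
    (isIntegral_algebraMap (x := (⟨b ^ p, hpow b⟩ : B)))⟩
  have : Module.Finite B A := Algebra.IsIntegral.finite
  have : Algebra.FormallyUnramified B A := by
    refine ⟨?_⟩
    rw [← Submodule.subsingleton_iff A, ← subsingleton_iff_bot_eq_top, eq_comm, eq_bot_iff,
      ← LinearMap.range_eq_top.mpr (KaehlerDifferential.map_surjective k B A),
      LinearMap.range_eq_map, ← hs, Submodule.map_span, Submodule.span_le]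
    rintro _ ⟨_, ⟨x, hx, rfl⟩, rfl⟩
    rw [KaehlerDifferential.map_D]
    exact (D B A).map_algebraMap ⟨x, Algebra.subset_adjoin (Or.inr hx)⟩
  have hnil : IsNilpotent (KaehlerDifferential.ideal B A) := by
    rw [Ideal.FG.isNilpotent_iff_le_nilradical (KaehlerDifferential.ideal_fg B A),
      ← KaehlerDifferential.span_range_eq_ideal, Ideal.span_le]
    rintro _ ⟨b, rfl⟩
    refine ⟨p, ?_⟩
    have : Nontrivial (TensorProduct B A A) :=
      (Algebra.TensorProduct.lmul' (S := A) B).toRingHom.domain_nontrivial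
    have : CharP k p := (RingHom.charP_iff _ (algebraMap k A).injective p).mpr ‹_›
    have : CharP (TensorProduct B A A) p :=
      charP_of_injective_algebraMap (algebraMap k (TensorProduct B A A)).injective p
    change _ = 0
    rw [sub_pow_char, Algebra.TensorProduct.tmul_pow, Algebra.TensorProduct.tmul_pow, one_pow,
      sub_eq_zero]
    have : b ^ p = (⟨b ^ p, hpow b⟩ : B) • (1 : A) := by
      rw [Algebra.smul_def, mul_one]; rfl
    rw [this, TensorProduct.smul_tmul]
  have hepi : Algebra.IsEpi B A := by
    rw [Algebra.isEpi_iff_forall_one_tmul_eq]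
    intro a
    have := Algebra.FormallyUnramified.ext (R := B)
      (g₁ := (Algebra.TensorProduct.includeRight : A →ₐ[B] TensorProduct B A A))
      (g₂ := Algebra.TensorProduct.includeLeft) _ hnil fun x ↦ by
        rw [Ideal.Quotient.eq]
        exact KaehlerDifferential.one_smul_sub_smul_one_mem_ideal B x
    exact DFunLike.congr_fun this a
  rw [eq_top_iff]
  rintro a -
  obtain ⟨b, rfl⟩ := Algebra.isEpi_iff_surjective_algebraMap_of_finite.mp hepi a
  exact b.2

theorem exists_eq_pow_char_of_mem_adjoin [PerfectRing k p] {a : A} [ExpChar k p]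
    (ha : a ∈ Algebra.adjoin k (Set.range fun b : A ↦ b ^ p)) : ∃ b : A, a = b ^ p := by
  induction ha using Algebra.adjoin_induction with
  | mem x hx => exact hx.imp fun _ h ↦ h.symm
  | algebraMap r =>
    obtain ⟨t, rfl⟩ := surjective_frobenius k p r
    exact ⟨algebraMap k A t, by simp [frobenius_def]⟩
  | add x y _ _ hx hy =>
    obtain ⟨b, rfl⟩ := hx
    obtain ⟨c, rfl⟩ := hy
    exact ⟨b + c, (add_pow_char b c p).symm⟩
  | mul x y _ _ hx hy =>
    obtain ⟨b, rfl⟩ := hx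
    obtain ⟨c, rfl⟩ := hy
    exact ⟨b * c, (mul_pow b c p).symm⟩

/-- If `Ω[A⁄k]` has a basis of exact differentials, then every element killed by `d` is a
`p`-th power. -/
theorem exists_eq_pow_char_of_basis [PerfectRing k p] [ExpChar k p] [Algebra.FiniteType k A]
    {ι : Type*} (b : Module.Basis ι A Ω[A⁄k]) (x : ι → A) (hb : ∀ i, b i = D k A (x i)) {a : A}
    (ha : D k A a = 0) : ∃ c : A, a = c ^ p := by
  classical
  nontriviality A
  have : Fintype ι := @Fintype.ofFinite _ (Module.Finite.finite_basis b)
  let C (s : Finset ι) := Algebra.adjoin k (Set.range (fun c : A ↦ c ^ p) ∪ x '' s)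
  have hC (s : Finset ι) (h : a ∈ C s) : a ∈ C ∅ := by
    induction s using Finset.induction_on with
    | empty => exact h
    | insert i s hi ih =>
      apply ih
      let E : Derivation k A A := (b.coord i).compDer (D k A)
      have hE (j : ι) : E (x j) = if i = j then 1 else 0 := by
        simp [E, ← hb, Finsupp.single_apply, eq_comm]
      have hpow (c : A) : c ^ p ∈ C s := Algebra.subset_adjoin (Or.inl ⟨c, rfl⟩)
      refine E.mem_of_mem_adjoin_of_apply_eq_zero p (C s) hpow ?_ (x := x i) (by simp [hE]) ?_
        (by simp [E, ha])
      · have : Set.EqOn E (0 : Derivation k A A) (C s) := by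
          apply Derivation.eqOn_adjoin
          rintro _ (⟨c, rfl⟩ | ⟨j, hj, rfl⟩)
          · exact E.map_pow_char p c
          · have : i ≠ j := by rintro rfl; exact hi hj
            simp [hE, this]
        exact fun c hc ↦ this hc
      · rwa [← Subalgebra.mem_restrictScalars k, ← Algebra.adjoin_union_eq_adjoin_adjoin,
          Set.union_assoc, ← Set.image_singleton, ← Set.image_union, Set.union_singleton,
          ← Finset.coe_insert]
  have htop : C Finset.univ = ⊤ := by
    apply adjoin_pow_char_union_eq_top
    rw [Finset.coe_univ, Set.image_univ, ← Set.range_comp, ← b.span_eq]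
    congr 2
    exact (funext hb).symm
  refine exists_eq_pow_char_of_mem_adjoin (k := k) p ?_
  simpa [C] using hC Finset.univ (htop ▸ Algebra.mem_top)

end PthPowers

/-- **Degree-zero Cartier.** Let `k` be a perfect field of characteristic `p` and `A` a
smooth `k`-algebra. For `a ∈ A`, `da = 0` in `Ω¹_{A/k}` if and only if `a = b^p` for some
`b ∈ A`. -/
theorem d_eq_zero_iff_pth_power
    {k A : Type u} [Field k] [PerfectField k] (p : ℕ) [Fact p.Prime] [CharP k p]
    [CommRing A] [Algebra k A] [Algebra.Smooth k A] (a : A) :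
    KaehlerDifferential.D k A a = 0 ↔ ∃ b : A, a = b ^ p := by
  have : ExpChar k p := .prime Fact.out
  rcases subsingleton_or_nontrivial A with _ | _
  · exact ⟨fun _ ↦ ⟨0, Subsingleton.elim _ _⟩, fun _ ↦ by simp [Subsingleton.elim a 0]⟩
  have : CharP A p := charP_of_injective_algebraMap (algebraMap k A).injective p
  refine ⟨fun ha ↦ ?_, ?_⟩
  · obtain ⟨s, hs, hstd⟩ := Algebra.Smooth.exists_span_eq_top_isStandardSmooth k A
    refine exists_eq_pow_char_of_span_eq_top p hs fun f hf ↦ ?_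
    rcases subsingleton_or_nontrivial (Localization.Away f) with _ | _
    · exact ⟨0, Subsingleton.elim _ _⟩
    have : CharP (Localization.Away f) p :=
      charP_of_injective_algebraMap (algebraMap k (Localization.Away f)).injective p
    have := hstd f hf
    obtain ⟨-, ι, b, hb⟩ :=
      (Algebra.IsStandardSmooth.iff_exists_basis_kaehlerDifferential (R := k)
        (S := Localization.Away f)).mp this
    choose x hx using fun i ↦ hb ⟨i, rfl⟩
    refine exists_eq_pow_char_of_basis (k := k) p b x (fun i ↦ (hx i).symm) ?_
    rw [← KaehlerDifferential.map_D k k A, ha, map_zero]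
  · rintro ⟨b, rfl⟩
    rw [Derivation.leibniz_pow, ← Nat.cast_smul_eq_nsmul A, CharP.cast_eq_zero, zero_smul]
end
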